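/- For every infinite cardinal κ, the number of topological types of trees of size κ is exactly κ⁺. Precisely: if V is a type of cardinality κ, then the quotient of the set of trees with vertex set V by the equivalence relation ≡ (same topological type) has cardinality exactly κ⁺, the successor cardinal of κ. -/

import Mathlib

universe u v

/-- A topological minor embedding of `H` into `G`: an injective map `toFun` on vertices
together with, for each edge of `H`, a path in `G` joining the images of its endpoints,
such that distinct edges get internally vertex-disjoint paths whose internal vertices
avoid the image of `toFun`. -/
structure TopMinorEmb {V : Type u} {W : Type v} (H : SimpleGraph V) (G : SimpleGraph W) where
  toFun : V → W
  inj : Function.Injective toFun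
  path : ∀ ⦃a b : V⦄, H.Adj a b → G.Walk (toFun a) (toFun b)
  path_isPath : ∀ ⦃a b : V⦄ (h : H.Adj a b), (path h).IsPath
  path_symm : ∀ ⦃a b : V⦄ (h : H.Adj a b), path h.symm = (path h).reverse
  internal_avoid_image : ∀ ⦃a b : V⦄ (h : H.Adj a b) (w : W),
      w ∈ (path h).support → w ≠ toFun a → w ≠ toFun b → ∀ x : V, toFun x ≠ w
  internally_disjoint : ∀ ⦃a b a' b' : V⦄ (h : H.Adj a b) (h' : H.Adj a' b'),
      s(a, b) ≠ s(a', b') → ∀ w : W,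
        w ∈ (path h).support → w ∈ (path h').support → w = toFun a ∨ w = toFun b

/-- `H ≤ G`: some subdivision of `H` embeds as a subgraph into `G`. -/
def TopMinorLE {V : Type u} {W : Type v} (H : SimpleGraph V) (G : SimpleGraph W) : Prop :=
  Nonempty (TopMinorEmb H G)

/-- `G ≡ H`: `G` and `H` have the same topological type. -/
def TopEquiv {V : Type u} {W : Type v} (G : SimpleGraph V) (H : SimpleGraph W) : Prop :=
  TopMinorLE G H ∧ TopMinorLE H G

namespace Arrays

/-- The nonprincipal ultrafilter with respect to which all arrays are taken. -/
noncomputable abbrev U : Ultrafilter ℕ := Filter.hyperfilter ℕ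

/-- The branches of the tree described by a system of successor sets. -/
def Br (A : List ℕ → Set ℕ) : Set (Stream' ℕ) := {X | ∀ k, X.get k ∈ A (X.take k)}

/-- A set of streams is large if it contains all branches of a `U`-branching tree. -/
def Large (S : Stream' ℕ → Prop) : Prop :=
  ∃ A : List ℕ → Set ℕ, (∀ s, A s ∈ U) ∧ ∀ X ∈ Br A, S X

theorem mem_br_cons {A : List ℕ → Set ℕ} {n : ℕ} {X : Stream' ℕ} :
    Stream'.cons n X ∈ Br A ↔ n ∈ A [] ∧ X ∈ Br fun s => A (n :: s) := by
  constructor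
  · intro h
    exact ⟨h 0, fun k => h (k + 1)⟩
  · rintro ⟨h0, h⟩ k
    cases k with
    | zero => exact h0
    | succ k => exact h k

theorem Large.mono {S T : Stream' ℕ → Prop} (h : Large S) (hST : ∀ X, S X → T X) : Large T := by
  obtain ⟨A, hA, h⟩ := h
  exact ⟨A, hA, fun X hX => hST X (h X hX)⟩

theorem Large.and {S T : Stream' ℕ → Prop} (h : Large S) (h' : Large T) :
    Large fun X => S X ∧ T X := by
  obtain ⟨A, hA, h⟩ := h
  obtain ⟨A', hA', h'⟩ := h'
  exact ⟨fun s => A s ∩ A' s, fun s => Filter.inter_mem (hA s) (hA' s),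
    fun X hX => ⟨h X fun k => (hX k).1, h' X fun k => (hX k).2⟩⟩

theorem large_of_forall {S : Stream' ℕ → Prop} (h : ∀ X, S X) : Large S :=
  ⟨fun _ => Set.univ, fun _ => Filter.univ_mem, fun X _ => h X⟩

theorem large_iff_cons {S : Stream' ℕ → Prop} :
    Large S ↔ ∀ᶠ n in U, Large fun X => S (Stream'.cons n X) := by
  classical
  constructor
  · rintro ⟨A, hA, h⟩
    filter_upwards [hA []] with n hn
    exact ⟨fun s => A (n :: s), fun s => hA _, fun X hX => h _ (mem_br_cons.2 ⟨hn, hX⟩)⟩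
  · intro h
    have h' : ∀ n, ∃ A : List ℕ → Set ℕ, (∀ s, A s ∈ U) ∧
        ((Large fun X => S (Stream'.cons n X)) → ∀ X ∈ Br A, S (Stream'.cons n X)) := by
      intro n
      by_cases hn : Large fun X => S (Stream'.cons n X)
      · obtain ⟨A, hA, hS⟩ := hn
        exact ⟨A, hA, fun _ => hS⟩
      · exact ⟨fun _ => Set.univ, fun _ => Filter.univ_mem, fun h => absurd h hn⟩
    choose A hA hS using h'
    refine ⟨fun s => match s with
      | [] => {n | Large fun X => S (Stream'.cons n X)}
      | n :: s => A n s, ?_, ?_⟩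
    · rintro (_ | ⟨n, s⟩)
      · exact h
      · exact hA n s
    · intro X hX
      rw [← Stream'.eta X] at hX ⊢
      rw [mem_br_cons] at hX
      exact hS _ hX.1 _ hX.2

theorem exists_mem_br {A : List ℕ → Set ℕ} (hA : ∀ s, A s ∈ U) : ∃ X, X ∈ Br A := by
  have h : ∀ s, ∃ n, n ∈ A s := fun s => Ultrafilter.nonempty_of_mem (hA s)
  choose f hf using h
  let g : ℕ → List ℕ := fun k => Nat.rec [] (fun _ s => s ++ [f s]) k
  let X : Stream' ℕ := (fun k => f (g k) : ℕ → ℕ)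
  have hX : ∀ k, X.take k = g k := by
    intro k
    induction k with
    | zero => rfl
    | succ k ih => rw [Stream'.take_succ', ih]; rfl
  refine ⟨X, fun k => ?_⟩
  rw [hX]
  exact hf _

theorem Large.exists {S : Stream' ℕ → Prop} (h : Large S) : ∃ X, S X := by
  obtain ⟨A, hA, h⟩ := h
  obtain ⟨X, hX⟩ := exists_mem_br hA
  exact ⟨X, h X hX⟩

/-- Almost every branch above the stem meets the predicate. -/
inductive Bar (P : List ℕ → Prop) : List ℕ → Prop
  | base (t : List ℕ) : P t → Bar P t
  | step (t : List ℕ) (B : Set ℕ) (hB : B ∈ U) : (∀ n ∈ B, Bar P (t ++ [n])) → Bar P t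

theorem Bar.of_eventually {P : List ℕ → Prop} {t : List ℕ}
    (h : ∀ᶠ n in U, Bar P (t ++ [n])) : Bar P t :=
  Bar.step t _ h fun _ hn => hn

theorem Bar.bind {P Q : List ℕ → Prop} {t : List ℕ} (h : Bar P t)
    (hPQ : ∀ t, P t → Bar Q t) : Bar Q t := by
  induction h with
  | base t h => exact hPQ t h
  | step t B hB _ ih => exact Bar.step t B hB ih

theorem Bar.mono {P Q : List ℕ → Prop} {t : List ℕ} (h : Bar P t)
    (hPQ : ∀ t, P t → Q t) : Bar Q t :=
  h.bind fun t ht => Bar.base t (hPQ t ht)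

theorem append_cons_stream (t : List ℕ) (n : ℕ) (X : Stream' ℕ) :
    t ++ₛ Stream'.cons n X = (t ++ [n]) ++ₛ X := by
  rw [Stream'.append_append_stream]
  rfl

/-- A bar which is preserved under extension by almost all elements can be intersected. -/
theorem Bar.and {P Q : List ℕ → Prop} (hP : ∀ t, P t → ∀ᶠ n in U, P (t ++ [n]))
    (hQ : ∀ t, Q t → ∀ᶠ n in U, Q (t ++ [n])) {t : List ℕ} (h : Bar P t) (h' : Bar Q t) :
    Bar (fun s => P s ∧ Q s) t := by
  induction h with
  | base t h =>
    induction h' with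
    | base t h' => exact Bar.base t ⟨h, h'⟩
    | step t B hB _ ih =>
      apply Bar.of_eventually
      filter_upwards [hB, hP t h] with n hn hn'
      exact ih n hn hn'
  | step t B hB hb ih =>
    have key : ∀ t, Bar Q t → Q t ∨ ∀ᶠ n in U, Bar Q (t ++ [n]) := by
      intro t h
      cases h with
      | base _ h => exact Or.inl h
      | step _ B hB h => exact Or.inr (Filter.mem_of_superset hB h)
    apply Bar.of_eventually
    rcases key t h' with h' | h'
    · filter_upwards [hB, hQ t h'] with n hn hn'
      exact ih n hn (Bar.base _ hn')
    · filter_upwards [hB, h'] with n hn hn'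
      exact ih n hn hn'

/-- A function on streams which, up to large sets, is decided along almost every branch. -/
def Tame {Q : Type*} (F : Stream' ℕ → Q) : Prop :=
  ∀ t, Bar (fun s => ∃ q, Large fun X => F (s ++ₛ X) = q) t

/-- A property of streams which is decided up to large sets above every stem. -/
def Decided (c : Stream' ℕ → Prop) : Prop :=
  ∀ t, (Large fun X => c (t ++ₛ X)) ∨ Large fun X => ¬ c (t ++ₛ X)

theorem large_append_iff {c : Stream' ℕ → Prop} {t : List ℕ} :
    (Large fun X => c (t ++ₛ X)) ↔ ∀ᶠ n in U, Large fun X => c ((t ++ [n]) ++ₛ X) := by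
  rw [large_iff_cons]
  simp only [append_cons_stream]

variable {Q Q' : Type*}

theorem large_eq_extend (F : Stream' ℕ → Q) (t : List ℕ)
    (h : ∃ q, Large fun X => F (t ++ₛ X) = q) :
    ∀ᶠ n in U, ∃ q, Large fun X => F ((t ++ [n]) ++ₛ X) = q := by
  obtain ⟨q, hq⟩ := h
  rw [large_append_iff (c := fun X => F X = q)] at hq
  filter_upwards [hq] with n hn
  exact ⟨q, hn⟩

theorem Tame.comp {F : Stream' ℕ → Q} (hF : Tame F) (φ : Q → Q') : Tame fun X => φ (F X) :=
  fun t => (hF t).mono fun _ ⟨q, hq⟩ => ⟨φ q, hq.mono fun _ h => congrArg φ h⟩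

theorem Tame.prodMk {F : Stream' ℕ → Q} {G : Stream' ℕ → Q'} (hF : Tame F) (hG : Tame G) :
    Tame fun X => (F X, G X) := fun t =>
  (Bar.and (large_eq_extend F) (large_eq_extend G) (hF t) (hG t)).mono
    fun _ ⟨⟨q, hq⟩, ⟨q', hq'⟩⟩ => ⟨(q, q'), (hq.and hq').mono fun _ h => Prod.ext h.1 h.2⟩

theorem Tame.tail {F : Stream' ℕ → Q} (hF : Tame F) : Tame fun X => F X.tail := by
  have key : ∀ n s, Bar (fun s => ∃ q, Large fun X => F (s ++ₛ X) = q) s →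
      Bar (fun s => ∃ q, Large fun X => F (s ++ₛ X).tail = q) (n :: s) := by
    intro n s h
    induction h with
    | base s h => exact Bar.base _ h
    | step s B hB _ ih => exact Bar.step _ B hB ih
  rintro (_ | ⟨n, s⟩)
  · exact Bar.step _ Set.univ Filter.univ_mem fun n _ => key n [] (hF [])
  · exact key n s (hF s)

theorem tame_head (x : ℕ → Q) : Tame fun X => x X.head := by
  rintro (_ | ⟨n, s⟩)
  · exact Bar.step _ Set.univ Filter.univ_mem fun n _ =>
      Bar.base _ ⟨x n, large_of_forall fun _ => rfl⟩
  · exact Bar.base _ ⟨x n, large_of_forall fun _ => rfl⟩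

theorem Bar.decided {P : List ℕ → Prop} {c : Stream' ℕ → Prop} {t : List ℕ} (h : Bar P t)
    (hP : ∀ t, P t → (Large fun X => c (t ++ₛ X)) ∨ Large fun X => ¬ c (t ++ₛ X)) :
    (Large fun X => c (t ++ₛ X)) ∨ Large fun X => ¬ c (t ++ₛ X) := by
  induction h with
  | base t h => exact hP t h
  | step t B hB _ ih =>
    rw [large_append_iff (c := c), large_append_iff (c := fun X => ¬ c X),
      ← Ultrafilter.eventually_or]
    exact Filter.mem_of_superset hB ih

theorem Tame.decided {F : Stream' ℕ → Q} (hF : Tame F) (c : Q → Prop) :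
    Decided fun X => c (F X) := by
  intro t
  refine (hF t).decided (c := fun X => c (F X)) ?_
  rintro s ⟨q, hq⟩
  by_cases hc : c q
  · exact Or.inl (hq.mono fun X h => by rwa [h])
  · exact Or.inr (hq.mono fun X h => by rwa [h])

theorem Decided.not {c : Stream' ℕ → Prop} (hc : Decided c) : Decided fun X => ¬ c X := fun t =>
  (hc t).symm.imp id fun h => h.mono fun _ h => not_not.2 h

theorem Decided.tame {c : Stream' ℕ → Prop} (hc : Decided c) : Tame c := fun t =>
  Bar.base t <| by
    rcases hc t with h | h
    · exact ⟨True, h.mono fun _ h => eq_true h⟩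
    · exact ⟨False, h.mono fun _ h => eq_false h⟩

theorem bar_or_large_forall_not {c : ℕ → Stream' ℕ → Prop} (hc : ∀ i, Decided (c i))
    (t : List ℕ) : Bar (fun s => ∃ i, Large fun X => c i (s ++ₛ X)) t ∨
      Large fun X => ∀ i, ¬ c i (t ++ₛ X) := by
  by_cases ht : Bar (fun s => ∃ i, Large fun X => c i (s ++ₛ X)) t
  · exact Or.inl ht
  right
  set b := Bar (fun s => ∃ i, Large fun X => c i (s ++ₛ X)) with hb
  have h1 : ∀ s i, ∃ A : List ℕ → Set ℕ, (∀ r, A r ∈ U) ∧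
      (¬ b s → ∀ X ∈ Br A, ¬ c i (s ++ₛ X)) := by
    intro s i
    by_cases hs : b s
    · exact ⟨fun _ => Set.univ, fun _ => Filter.univ_mem, fun h => absurd hs h⟩
    · rcases hc i s with h | ⟨A, hA, h⟩
      · exact absurd (Bar.base s ⟨i, h⟩) hs
      · exact ⟨A, hA, fun _ => h⟩
  choose A hA hA' using h1
  have h2 : ∀ s, {n | ¬ b s → ¬ b (s ++ [n])} ∈ U := by
    intro s
    by_cases hs : b s
    · exact Filter.univ_mem' fun n h => absurd hs h
    · have : ¬ ∀ᶠ n in U, b (s ++ [n]) := fun h => hs (Bar.of_eventually h)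
      rw [← Ultrafilter.eventually_not] at this
      exact Filter.mem_of_superset this fun n hn _ => hn
  refine ⟨fun s => {n | ¬ b (t ++ s) → ¬ b (t ++ s ++ [n])} ∩
    ⋂ j ∈ Finset.range (s.length + 1), A (t ++ s.take j) j (s.drop j), ?_, ?_⟩
  · intro s
    exact Filter.inter_mem (h2 _)
      ((Filter.biInter_finset_mem _).2 fun j _ => hA _ _ _)
  · intro X hX i
    have h3 : ∀ k, ¬ b (t ++ X.take k) := by
      intro k
      induction k with
      | zero => simpa using ht
      | succ k ih =>
        rw [Stream'.take_succ', ← List.append_assoc]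
        exact (hX k).1 ih
    have h4 := hA' (t ++ X.take i) i (h3 i) (X.drop i) ?_
    · rwa [Stream'.append_append_stream, Stream'.append_take_drop] at h4
    · intro k
      have h5 := Set.mem_iInter₂.1 (hX (i + k)).2 i (by simp)
      have h6 : (X.take (i + k)).take i = X.take i := by
        rw [Stream'.take_take]
        simp
      have h7 : (X.take (i + k)).drop i = (X.drop i).take k := by
        rw [Stream'.take_drop]
      rw [h6, h7] at h5
      rwa [Stream'.get_drop]

theorem Decided.exists {c : ℕ → Stream' ℕ → Prop} (hc : ∀ i, Decided (c i)) :
    Decided fun X => ∃ i, c i X := by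
  intro t
  rcases bar_or_large_forall_not hc t with h | h
  · refine h.decided (c := fun X => ∃ i, c i X) ?_
    rintro s ⟨i, hi⟩
    exact Or.inl (hi.mono fun _ h => ⟨i, h⟩)
  · exact Or.inr (h.mono fun _ h => by simpa using h)

theorem Decided.forall {c : ℕ → Stream' ℕ → Prop} (hc : ∀ i, Decided (c i)) :
    Decided fun X => ∀ i, c i X := by
  have := (Decided.exists fun i => (hc i).not).not
  simpa using this

theorem Tame.bar_of_large_eq {F G : Stream' ℕ → Q} (hF : Tame F) {t : List ℕ}
    (h : Large fun X => G (t ++ₛ X) = F (t ++ₛ X)) :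
    Bar (fun s => ∃ q, Large fun X => G (s ++ₛ X) = q) t := by
  have h1 := Bar.and (large_eq_extend F) (Q := fun s => Large fun X => G (s ++ₛ X) = F (s ++ₛ X))
    (fun t => (large_append_iff (c := fun X => G X = F X)).1) (hF t) (Bar.base t h)
  exact h1.mono fun s ⟨⟨q, hq⟩, h⟩ => ⟨q, (hq.and h).mono fun X h => by rw [h.2, h.1]⟩

/-- Tame functions are closed under eventually constant limits. -/
theorem Tame.limit {F : ℕ → Stream' ℕ → Q} {G : Stream' ℕ → Q} (hF : ∀ k, Tame (F k))
    (hG : ∀ X, ∃ N, ∀ k, N ≤ k → F k X = G X) : Tame G := by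
  have hdec : ∀ N, Decided fun X => ∀ k, N ≤ k → F k X = F N X := by
    intro N
    refine Decided.forall fun k => ?_
    exact ((hF k).prodMk (hF N)).decided fun p => N ≤ k → p.1 = p.2
  intro t
  rcases bar_or_large_forall_not hdec t with h | h
  · refine h.bind fun s ⟨N, hN⟩ => (hF N).bar_of_large_eq (hN.mono fun X h => ?_)
    obtain ⟨M, hM⟩ := hG (s ++ₛ X)
    rw [← hM (max M N) (le_max_left _ _), h _ (le_max_right _ _)]
  · obtain ⟨X, hX⟩ := h.exists
    obtain ⟨N, hN⟩ := hG (t ++ₛ X)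
    exact absurd (fun k hk => by rw [hN k hk, hN N le_rfl]) (hX N)

open Classical in
theorem Tame.ite {c : Stream' ℕ → Prop} {F G : Stream' ℕ → Q} (hc : Decided c) (hF : Tame F)
    (hG : Tame G) : Tame fun X => if c X then F X else G X :=
  (hc.tame.prodMk (hF.prodMk hG)).comp fun p => if p.1 then p.2.1 else p.2.2

theorem take_append_add (t : List ℕ) (X : Stream' ℕ) (m : ℕ) :
    (t ++ₛ X).take (t.length + m) = t ++ X.take m := by
  induction t with
  | nil => simp
  | cons a t ih =>
    rw [List.length_cons, Nat.add_right_comm, Stream'.cons_append_stream, Stream'.take_succ_cons,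
      ih, List.cons_append]

theorem decided_mem_br {A : List ℕ → Set ℕ} (hA : ∀ s, A s ∈ U) : Decided fun X => X ∈ Br A := by
  intro t
  by_cases ht : ∀ k (hk : k < t.length), t[k] ∈ A (t.take k)
  · left
    refine ⟨fun s => A (t ++ s), fun s => hA _, fun X hX k => ?_⟩
    by_cases hk : k < t.length
    · rw [Stream'.get_append_left _ _ _ hk, Stream'.take_append_of_le_length _ _ _ hk.le]
      exact ht k hk
    · obtain ⟨m, rfl⟩ := Nat.exists_eq_add_of_le (not_lt.1 hk)
      rw [Stream'.get_append_right]
      rw [take_append_add]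
      exact hX m
  · right
    refine large_of_forall fun X hX => ht fun k hk => ?_
    have := hX k
    rwa [Stream'.get_append_left _ _ _ hk, Stream'.take_append_of_le_length _ _ _ hk.le] at this

/-- A hereditary system of `U`-large successor sets. -/
structure IsSys (A : List ℕ → Set ℕ) : Prop where
  mem : ∀ s, A s ∈ U
  cons_subset : ∀ n s, A (n :: s) ⊆ A s

theorem br_mono {A B : List ℕ → Set ℕ} (h : ∀ s, A s ⊆ B s) {X : Stream' ℕ} (hX : X ∈ Br A) :
    X ∈ Br B := fun k => h _ (hX k)

theorem IsSys.tail_mem {A : List ℕ → Set ℕ} (hA : IsSys A) {X : Stream' ℕ} (hX : X ∈ Br A) :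
    X.tail ∈ Br A := fun k => by
  have := hX (k + 1)
  rw [Stream'.take_succ] at this
  exact hA.cons_subset _ _ this

/-- The largest hereditary system below a given one. -/
def hered (A : List ℕ → Set ℕ) : List ℕ → Set ℕ
  | [] => A []
  | n :: s => A (n :: s) ∩ hered A s

theorem hered_subset (A : List ℕ → Set ℕ) : ∀ s, hered A s ⊆ A s
  | [] => subset_rfl
  | _ :: _ => Set.inter_subset_left

theorem isSys_hered {A : List ℕ → Set ℕ} (hA : ∀ s, A s ∈ U) : IsSys (hered A) where
  mem s := by
    induction s with
    | nil => exact hA _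
    | cons n s ih => exact Filter.inter_mem (hA _) ih
  cons_subset _ _ := Set.inter_subset_right

theorem Large.restrict {S : Stream' ℕ → Prop} (hS : Large S) {A : List ℕ → Set ℕ} (hA : IsSys A) :
    ∃ B, IsSys B ∧ (∀ s, B s ⊆ A s) ∧ ∀ X ∈ Br B, S X := by
  obtain ⟨A', hA', h⟩ := hS
  refine ⟨hered fun s => A s ∩ A' s, isSys_hered fun s => Filter.inter_mem (hA.mem s) (hA' s),
    fun s => (hered_subset _ s).trans Set.inter_subset_left, fun X hX => h X ?_⟩
  exact br_mono (fun s => (hered_subset _ s).trans Set.inter_subset_right) hX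

theorem Decided.restrict {c : Stream' ℕ → Prop} (hc : Decided c) {A : List ℕ → Set ℕ}
    (hA : IsSys A) : ∃ B, IsSys B ∧ (∀ s, B s ⊆ A s) ∧ ((∀ X ∈ Br B, c X) ∨ ∀ X ∈ Br B, ¬ c X) := by
  rcases hc [] with h | h
  · obtain ⟨B, hB, hBA, h⟩ := h.restrict hA
    exact ⟨B, hB, hBA, Or.inl h⟩
  · obtain ⟨B, hB, hBA, h⟩ := h.restrict hA
    exact ⟨B, hB, hBA, Or.inr h⟩

/-- The array `F` on the system `A` is bad for the relation `r`. -/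
structure IsBad (r : Q → Q → Prop) (F : Stream' ℕ → Q) (A : List ℕ → Set ℕ) : Prop where
  tame : Tame F
  isSys : IsSys A
  not_rel : ∀ X ∈ Br A, ¬ r (F X) (F X.tail)

theorem IsBad.restrict {r : Q → Q → Prop} {F : Stream' ℕ → Q} {A B : List ℕ → Set ℕ}
    (h : IsBad r F A) (hB : IsSys B) (hBA : ∀ s, B s ⊆ A s) : IsBad r F B :=
  ⟨h.tame, hB, fun X hX => h.not_rel X (br_mono hBA hX)⟩

/-- The better-quasi-order property of a relation on a set. -/
def BqoOn (r : Q → Q → Prop) (C : Set Q) : Prop :=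
  ∀ F A, IsBad r F A → ∃ X ∈ Br A, F X ∉ C

theorem BqoOn.exists_lt {r : Q → Q → Prop} {C : Set Q} (h : BqoOn r C) (f : ℕ → Q)
    (hf : ∀ n, f n ∈ C) : ∃ m n, m < n ∧ r (f m) (f n) := by
  by_contra! hbad
  have hB : IsBad r (fun X => f X.head) (fun s => {n | ∀ m ∈ s, m < n}) := by
    refine ⟨tame_head f, ⟨fun s => ?_, fun n s k hk m hm => hk m (List.mem_cons_of_mem _ hm)⟩,
      fun X hX => ?_⟩
    · have : {n | ∀ m ∈ s, m < n} = (⋃ m ∈ s.toFinset, Set.Iic m)ᶜ := by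
        ext n
        simp
      rw [this]
      exact Set.Finite.compl_mem_hyperfilter
        (Set.Finite.biUnion (Finset.finite_toSet _) fun m _ => Set.finite_Iic m)
    · exact hbad _ _ (hX 1 (X.get 0) (by simp [Stream'.take_succ, Stream'.head]))
  obtain ⟨X, -, hX⟩ := h _ _ hB
  exact hX (hf _)

theorem encode_le_encode_cons (n : ℕ) (s : List ℕ) :
    Encodable.encode s ≤ Encodable.encode (n :: s) := by
  rw [Encodable.encode_list_cons]
  exact (Nat.right_le_pair _ _).trans (Nat.le_succ _)

theorem encode_le_encode_append (t s : List ℕ) :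
    Encodable.encode t ≤ Encodable.encode (t ++ s) := by
  induction t with
  | nil => simp
  | cons n t ih =>
    rw [List.cons_append, Encodable.encode_list_cons, Encodable.encode_list_cons]
    rcases ih.eq_or_lt with h | h
    · rw [h]
    · exact Nat.succ_le_succ (Nat.pair_lt_pair_right _ h).le

theorem encode_take_le (X : Stream' ℕ) {i j : ℕ} (h : i ≤ j) :
    Encodable.encode (X.take i) ≤ Encodable.encode (X.take j) := by
  obtain ⟨m, rfl⟩ := Nat.exists_eq_add_of_le h
  rw [Stream'.take_add]
  exact encode_le_encode_append _ _

theorem le_encode_take (X : Stream' ℕ) (i : ℕ) : i ≤ Encodable.encode (X.take i) := by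
  have := Encodable.length_le_encode (X.take i)
  rwa [Stream'.length_take] at this

section Minimal

variable {r l : Q → Q → Prop}

/-- `q` lowers the bad array `p` on the branches through the stem with code `k`. -/
structure Lowers (l : Q → Q → Prop) (k : ℕ) (F : Stream' ℕ → Q) (A : List ℕ → Set ℕ)
    (G : Stream' ℕ → Q) (B : List ℕ → Set ℕ) : Prop where
  subset : ∀ s, B s ⊆ A s
  agree : ∀ s, Encodable.encode s < k → B s = A s
  le : ∀ X, G X = F X ∨ l (G X) (F X)
  lt : ∀ X ∈ Br B, ∀ i, Encodable.encode (X.take i) = k → l (G X) (F X)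

open Classical in
/-- The next approximation to a minimal bad array. -/
noncomputable def nextArray (r l : Q → Q → Prop) (k : ℕ)
    (p : {p : (Stream' ℕ → Q) × (List ℕ → Set ℕ) // IsBad r p.1 p.2}) :
    {p : (Stream' ℕ → Q) × (List ℕ → Set ℕ) // IsBad r p.1 p.2} :=
  if h : ∃ q : {p : (Stream' ℕ → Q) × (List ℕ → Set ℕ) // IsBad r p.1 p.2},
    Lowers l k p.1.1 p.1.2 q.1.1 q.1.2 then h.choose else p

/-- The sequence of approximations to a minimal bad array. -/
noncomputable def arraySeq (r l : Q → Q → Prop)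
    (p : {p : (Stream' ℕ → Q) × (List ℕ → Set ℕ) // IsBad r p.1 p.2}) :
    ℕ → {p : (Stream' ℕ → Q) × (List ℕ → Set ℕ) // IsBad r p.1 p.2}
  | 0 => p
  | k + 1 => nextArray r l k (arraySeq r l p k)

theorem exists_minimal_bad (hrl : ∀ a b c, r a b → l b c → r a c)
    (hl : ∀ a b c, l a b → l b c → l a c) (hwf : WellFounded l)
    {F : Stream' ℕ → Q} {A : List ℕ → Set ℕ} (hF : IsBad r F A) :
    ∃ G B, IsBad r G B ∧ (∀ s, B s ⊆ A s) ∧ (∀ X, G X = F X ∨ l (G X) (F X)) ∧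
      ∀ H C, IsBad r H C → (∀ s, C s ⊆ B s) → ¬ ∀ X ∈ Br C, l (H X) (G X) := by
  classical
  let S := arraySeq r l ⟨(F, A), hF⟩
  have hS : ∀ k, S (k + 1) = nextArray r l k (S k) := fun k => rfl
  have hS0 : S 0 = ⟨(F, A), hF⟩ := rfl
  clear_value S
  have hstep : ∀ k, Lowers l k (S k).1.1 (S k).1.2 (S (k + 1)).1.1 (S (k + 1)).1.2 ∨
      S (k + 1) = S k := by
    intro k
    rw [hS, nextArray]
    split_ifs with h
    · exact Or.inl h.choose_spec
    · exact Or.inr rfl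
  have hlow : ∀ k G B, IsBad r G B → Lowers l k (S k).1.1 (S k).1.2 G B →
      Lowers l k (S k).1.1 (S k).1.2 (S (k + 1)).1.1 (S (k + 1)).1.2 := by
    intro k G B hG hL
    have h : ∃ q : {p : (Stream' ℕ → Q) × (List ℕ → Set ℕ) // IsBad r p.1 p.2},
      Lowers l k (S k).1.1 (S k).1.2 q.1.1 q.1.2 := ⟨⟨(G, B), hG⟩, hL⟩
    rw [hS, nextArray, dif_pos h]
    exact h.choose_spec
  have hsub : ∀ s j k, j ≤ k → (S k).1.2 s ⊆ (S j).1.2 s := by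
    intro s j k hjk
    induction k, hjk using Nat.le_induction with
    | base => rfl
    | succ k _ ih =>
      rcases hstep k with h | h
      · exact (h.subset s).trans ih
      · rwa [h]
  have hagree : ∀ s j k, Encodable.encode s < j → j ≤ k → (S k).1.2 s = (S j).1.2 s := by
    intro s j k hs hjk
    induction k, hjk using Nat.le_induction with
    | base => rfl
    | succ k hk ih =>
      rcases hstep k with h | h
      · rw [h.agree s (by omega), ih]
      · rw [h, ih]
  have hle : ∀ X j k, j ≤ k → (S k).1.1 X = (S j).1.1 X ∨ l ((S k).1.1 X) ((S j).1.1 X) := by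
    intro X j k hjk
    induction k, hjk using Nat.le_induction with
    | base => exact Or.inl rfl
    | succ k hk ih =>
      rcases hstep k with h | h
      · rcases h.le X with h | h
        · rwa [h]
        · rcases ih with h' | h'
          · right; rwa [← h']
          · exact Or.inr (hl _ _ _ h h')
      · rwa [h]
  have hirr : ∀ a, ¬ l a a := fun a h => hwf.irrefl.irrefl a h
  have hconst : ∀ X, ∃ N, ∀ k, N ≤ k → (S k).1.1 X = (S N).1.1 X := by
    intro X
    obtain ⟨q, ⟨N, rfl⟩, hq⟩ := hwf.has_min (Set.range fun k => (S k).1.1 X) ⟨_, 0, rfl⟩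
    refine ⟨N, fun k hk => (hle X N k hk).resolve_right (hq _ ⟨k, rfl⟩)⟩
  choose N hN using hconst
  let G : Stream' ℕ → Q := fun X => (S (N X)).1.1 X
  have hGS : ∀ X k, N X ≤ k → (S k).1.1 X = G X := hN
  have hGle : ∀ X k, G X = (S k).1.1 X ∨ l (G X) ((S k).1.1 X) := by
    intro X k
    rw [← hGS X (max (N X) k) (le_max_left _ _)]
    exact hle X _ _ (le_max_right _ _)
  let B : List ℕ → Set ℕ := fun s => (S (Encodable.encode s + 1)).1.2 s
  have hBS : ∀ s k, B s ⊆ (S k).1.2 s := by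
    intro s k
    rcases le_total k (Encodable.encode s + 1) with h | h
    · exact hsub s _ _ h
    · exact (hagree s _ _ (Nat.lt_succ_self _) h).symm.subset
  have hBS' : ∀ s k, Encodable.encode s < k → B s = (S k).1.2 s := fun s k h =>
    (hagree s _ _ (Nat.lt_succ_self _) h).symm
  have hB : IsSys B := by
    refine ⟨fun s => (S _).2.isSys.mem s, fun n s => ?_⟩
    exact ((S _).2.isSys.cons_subset n s).trans
      (hBS' s _ (Nat.lt_succ_of_le (encode_le_encode_cons n s))).symm.subset
  have hGtame : Tame G := Tame.limit (fun k => (S k).2.tame) fun X => ⟨N X, hGS X⟩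
  have hGbad : IsBad r G B := by
    refine ⟨hGtame, hB, fun X hX => ?_⟩
    have := (S (max (N X) (N X.tail))).2.not_rel X (br_mono (fun s => hBS s _) hX)
    rwa [hGS _ _ (le_max_left _ _), hGS _ _ (le_max_right _ _)] at this
  refine ⟨G, B, hGbad, fun s => by simpa [hS0] using hBS s 0,
    fun X => by simpa [hS0] using hGle X 0, ?_⟩
  intro H C hH hCB hHG
  obtain ⟨X, hX⟩ := exists_mem_br hH.isSys.mem
  obtain ⟨k, hk⟩ : ∃ k, k = Encodable.encode (X.take (N X)) := ⟨_, rfl⟩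
  have hNk : N X ≤ k := hk ▸ le_encode_take X (N X)
  let H' : Stream' ℕ → Q := fun Y => if Y ∈ Br C then H Y else G Y
  let B' : List ℕ → Set ℕ := fun s => if Encodable.encode s < k then B s else C s
  have hB'B : ∀ s, B' s ⊆ B s := by
    intro s
    by_cases h : Encodable.encode s < k
    · simp [B', h]
    · simpa [B', h] using hCB s
  have hB' : IsSys B' := by
    constructor
    · intro s
      by_cases h : Encodable.encode s < k
      · simpa [B', h] using hB.mem s
      · simpa [B', h] using hH.isSys.mem s
    · intro n s
      by_cases h : Encodable.encode s < k
      · exact (hB'B _).trans ((hB.cons_subset n s).trans (by simp [B', h]))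
      · have h' : ¬ Encodable.encode (n :: s) < k := fun h' =>
          h ((encode_le_encode_cons n s).trans_lt h')
        simpa only [B', h, h', if_false] using hH.isSys.cons_subset n s
  have hH'bad : IsBad r H' B' := by
    refine ⟨Tame.ite (decided_mem_br hH.isSys.mem) hH.tame hGtame, hB', fun Y hY => ?_⟩
    by_cases h1 : Y ∈ Br C
    · have h2 := hH.isSys.tail_mem h1
      simpa [H', h1, h2] using hH.not_rel Y h1
    · have hbad := hGbad.not_rel Y (br_mono hB'B hY)
      by_cases h2 : Y.tail ∈ Br C
      · simp only [H', h1, h2, if_true, if_false]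
        exact fun h => hbad (hrl _ _ _ h (hHG _ h2))
      · simpa only [H', h1, h2, if_false] using hbad
  have hL : Lowers l k (S k).1.1 (S k).1.2 H' B' := by
    refine ⟨fun s => (hB'B s).trans (hBS s k), fun s hs => ?_, fun Y => ?_, fun Y hY i hi => ?_⟩
    · simp only [B', hs, if_true, hBS' s k hs]
    · by_cases h1 : Y ∈ Br C
      · simp only [H', h1, if_true]
        right
        rcases hGle Y k with h | h
        · rw [← h]; exact hHG Y h1
        · exact hl _ _ _ (hHG Y h1) h
      · simpa only [H', h1, if_false] using hGle Y k
    · rw [hk] at hi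
      have hYX := Encodable.encode_injective hi
      have hi' : i = N X := by
        have := congrArg List.length hYX
        simpa using this
      subst hi'
      have h1 : Y ∈ Br C := by
        intro j
        by_cases hj : j < N X
        · have h3 : Y.take (j + 1) = X.take (j + 1) := by
            have := congrArg (List.take (j + 1)) hYX
            rwa [Stream'.take_take, Stream'.take_take, min_eq_right (by omega)] at this
          rw [Stream'.take_succ', Stream'.take_succ'] at h3
          have h4 := List.append_inj' h3 rfl
          have h5 : Y.get j = X.get j := by simpa using h4.2
          rw [h4.1, h5]
          exact hX j
        · have h3 := hY j
          have h4 : ¬ Encodable.encode (Y.take j) < k := by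
            rw [hk, ← hYX, not_lt]
            exact encode_take_le Y (not_lt.1 hj)
          simpa only [B', h4, if_false] using h3
      simp only [H', h1, if_true]
      rcases hGle Y k with h | h
      · rw [← h]; exact hHG Y h1
      · exact hl _ _ _ (hHG Y h1) h
  have hlt := (hlow k H' B' hH'bad hL).lt X
    (br_mono (fun s => (hCB s).trans (hBS s _)) hX) (N X) hk.symm
  rw [hGS X k hNk, hGS X (k + 1) (by omega)] at hlt
  exact hirr _ hlt

end Minimal

theorem sublistForall₂_of_suffix {r : Q → Q → Prop} {a b c : List Q}
    (h : List.SublistForall₂ r a b) (hbc : b <:+ c) : List.SublistForall₂ r a c := by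
  obtain ⟨p, rfl⟩ := hbc
  induction p with
  | nil => exact h
  | cons x p ih => exact List.SublistForall₂.cons_right ih

/-- A bad array of lists yields a bad array of elements of these lists. -/
theorem IsBad.exists_mem_list {r : Q → Q → Prop} {F : Stream' ℕ → List Q}
    {A : List ℕ → Set ℕ} (hF : IsBad (List.SublistForall₂ r) F A) :
    ∃ G B, IsBad r G B ∧ (∀ s, B s ⊆ A s) ∧ ∀ X ∈ Br B, G X ∈ F X := by
  obtain ⟨G, B, hG, hBA, hGF, hmin⟩ := exists_minimal_bad (r := List.SublistForall₂ r)
    (l := fun a b => a <:+ b ∧ a.length < b.length)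
    (fun a b c h h' => sublistForall₂_of_suffix h h'.1)
    (fun a b c h h' => ⟨h.1.trans h'.1, h.2.trans h'.2⟩)
    (Subrelation.wf (fun h => h.2) (InvImage.wf List.length Nat.lt_wfRel.wf)) hF
  have hne : ∀ X ∈ Br B, G X ≠ [] := fun X hX h =>
    hG.not_rel X hX (h ▸ List.SublistForall₂.nil)
  obtain ⟨X₀, hX₀⟩ := exists_mem_br hG.isSys.mem
  let q := (G X₀).head (hne X₀ hX₀)
  let h : Stream' ℕ → Q := fun X => (G X).headD q
  have hh : Tame h := hG.tame.comp fun a => a.headD q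
  have hsplit : ∀ X ∈ Br B, h X :: (G X).tail = G X := by
    intro X hX
    have h1 := hne X hX
    revert h1
    simp only [h]
    cases G X <;> simp
  obtain ⟨C, hC, hCB, hc | hc⟩ :=
    ((hh.prodMk hh.tail).decided fun p => r p.1 p.2).restrict hG.isSys
  · refine absurd ?_ (hmin (fun X => (G X).tail) C
      ⟨hG.tame.comp _, hC, fun X hX hbad => ?_⟩ hCB)
    · intro X hX
      have h1 := hne X (br_mono hCB hX)
      refine ⟨List.tail_suffix _, ?_⟩
      have := List.length_pos_of_ne_nil h1
      simp only [List.length_tail]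
      omega
    · refine hG.not_rel X (br_mono hCB hX) ?_
      rw [← hsplit X (br_mono hCB hX), ← hsplit X.tail (br_mono hCB (hC.tail_mem hX))]
      exact List.SublistForall₂.cons (hc X hX) hbad
  · refine ⟨h, C, ⟨hh, hC, hc⟩, fun s => (hCB s).trans (hBA s), fun X hX => ?_⟩
    have h1 : h X ∈ G X := by
      rw [← hsplit X (br_mono hCB hX)]
      exact List.mem_cons_self
    rcases hGF X with h2 | h2
    · rwa [← h2]
    · exact h2.1.subset h1

end Arrays

section Multisets

open Cardinal

variable {Q : Type v}

/-- The relation `r` has no bad sequence in the family `m`. -/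
def WqoFamily {I : Type*} (r : Q → Q → Prop) (m : I → Q) : Prop :=
  ∀ f : ℕ → I, ∃ a b, a < b ∧ r (m (f a)) (m (f b))

theorem WqoFamily.exists_finite_basis {I : Type*} {r : Q → Q → Prop} {m : I → Q}
    (h : WqoFamily r m) (S : Set I) :
    ∃ T : Finset I, (∀ t ∈ T, t ∈ S) ∧ ∀ s ∈ S, ∃ t ∈ T, r (m t) (m s) := by
  by_contra! hT
  obtain ⟨f, -, hf⟩ := exists_seq_of_forall_finset_exists (fun i => i ∈ S)
    (fun i j => ¬ r (m i) (m j)) fun T hTS => hT T hTS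
  obtain ⟨a, b, hab, hr⟩ := h f
  exact hf a b hab hr

theorem mk_biUnion_finset_lt {I : Type u} {lam : Cardinal.{u}} (hlam : ℵ₀ ≤ lam) (T : Finset I)
    (D : I → Set I) (hD : ∀ t ∈ T, #(D t) < lam) : #(⋃ t ∈ T, D t : Set I) < lam := by
  classical
  induction T using Finset.induction_on with
  | empty => simpa using aleph0_pos.trans_le hlam
  | insert a T ha ih =>
    rw [Finset.set_biUnion_insert]
    exact (mk_union_le _ _).trans_lt (add_lt_of_lt hlam (hD a (Finset.mem_insert_self _ _))
      (ih fun t ht => hD t (Finset.mem_insert_of_mem ht)))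

/-- The number of members of the family above the given one. -/
def upCard {I : Type u} (r : Q → Q → Prop) (m : I → Q) (i : I) : Cardinal.{u} :=
  #{j | r (m i) (m j)}

theorem WqoFamily.mk_upCard_lt {I : Type u} {r : Q → Q → Prop} {m : I → Q}
    (h : WqoFamily r m) {lam : Cardinal.{u}} (hlam : ℵ₀ ≤ lam) :
    #{i | upCard r m i < lam} < lam := by
  obtain ⟨T, hTS, hT⟩ := h.exists_finite_basis {i | upCard r m i < lam}
  refine (mk_le_mk_of_subset ?_).trans_lt
    (mk_biUnion_finset_lt hlam T (fun t => {j | r (m t) (m j)}) hTS)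
  intro s hs
  obtain ⟨t, ht, hts⟩ := hT s hs
  exact Set.mem_biUnion ht hts

theorem WqoFamily.mk_upCard_le {I : Type u} {r : Q → Q → Prop} {m : I → Q}
    (h : WqoFamily r m) {lam : Cardinal.{u}} (hlam : ℵ₀ ≤ lam) :
    #{i | upCard r m i ≤ lam} ≤ lam := by
  have := h.mk_upCard_lt (hlam.trans (Order.le_succ lam))
  simpa only [Order.lt_succ_iff] using this

/-- Greedy choice of distinct representatives along a well-order. -/
theorem exists_injective_of_wf {I J : Type u} (lt : I → I → Prop) (hwf : WellFounded lt)
    (htri : ∀ i j, i ≠ j → lt i j ∨ lt j i) (D : I → Set J)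
    (hD : ∀ i, #{i' | lt i' i} < #(D i)) :
    ∃ ι : I → J, Function.Injective ι ∧ ∀ i, ι i ∈ D i := by
  have hex : ∀ (i : I) (f : ∀ i', lt i' i → J), ∃ j ∈ D i, ∀ i' h, f i' h ≠ j := by
    intro i f
    by_contra! h
    refine (hD i).not_ge ?_
    refine (mk_le_mk_of_subset (t := Set.range fun i' : {i' | lt i' i} => f i'.1 i'.2) ?_).trans
      mk_range_le
    intro j hj
    obtain ⟨i', h', e⟩ := h j hj
    exact ⟨⟨i', h'⟩, e⟩
  choose g hg hg' using hex
  let ι : I → J := hwf.fix g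
  have hι : ∀ i, ι i = g i fun i' _ => ι i' := fun i => hwf.fix_eq g i
  refine ⟨ι, fun i j hij => ?_, fun i => by rw [hι]; exact hg _ _⟩
  by_contra hne
  rcases htri i j hne with h | h
  · exact hg' j (fun i' _ => ι i') i h (by rw [← hι, hij])
  · exact hg' i (fun i' _ => ι i') j h (by rw [← hι, hij])

theorem exists_injective_lt_ord {α : Type u} {c : Cardinal.{u}} (h : #α ≤ c) :
    ∃ f : α → Ordinal.{u}, Function.Injective f ∧ ∀ a, f a < c.ord := by
  rw [← mk_ord_toType c] at h
  obtain ⟨e⟩ := h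
  exact ⟨fun a => (Ordinal.ToType.mk.symm (e a)).1, Subtype.val_injective.comp
    (Ordinal.ToType.mk.symm.injective.comp e.injective), fun a => (Ordinal.ToType.mk.symm (e a)).2⟩

/-- Greedy choice of distinct representatives when few sets are small. -/
theorem exists_injective_of_mk_le {I J : Type u} (w : I → Cardinal.{u}) (hw : ∀ i, ℵ₀ ≤ w i)
    (hlt : ∀ i, #{i' | w i' < w i} < w i) (hle : ∀ i, #{i' | w i' ≤ w i} ≤ w i)
    (D : I → Set J) (hD : ∀ i, w i ≤ #(D i)) :
    ∃ ι : I → J, Function.Injective ι ∧ ∀ i, ι i ∈ D i := by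
  have hclass : ∀ c : Set.range w, ∃ f : {i // w i = c} → Ordinal.{u},
      Function.Injective f ∧ ∀ i, f i < (c : Cardinal.{u}).ord := by
    rintro ⟨_, i, rfl⟩
    refine exists_injective_lt_ord ((mk_le_mk_of_subset fun i' hi' => ?_).trans (hle i))
    exact le_of_eq hi'
  choose f hf hf' using hclass
  let pos : I → Ordinal.{u} := fun i => f ⟨w i, i, rfl⟩ ⟨i, rfl⟩
  have hpos : ∀ i, pos i < (w i).ord := fun i => hf' _ _
  have hinj : ∀ i j, w i = w j → pos i = pos j → i = j := by
    intro i j hij hp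
    have h2 : ∀ (c : Set.range w) (hj : w j = c), pos j = f c ⟨j, hj⟩ := by
      rintro ⟨c, h⟩ hj
      change w j = c at hj
      subst hj
      rfl
    exact congrArg Subtype.val (hf _ (hp.trans (h2 ⟨w i, i, rfl⟩ hij.symm)))
  refine exists_injective_of_wf (fun i j => w i < w j ∨ w i = w j ∧ pos i < pos j) ?_ ?_ D ?_
  · refine Subrelation.wf (r := InvImage (Prod.Lex (· < ·) (· < ·)) fun i => (w i, pos i)) ?_
      (InvImage.wf _ (WellFounded.prod_lex Cardinal.lt_wf Ordinal.lt_wf))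
    intro i j h
    exact Prod.lex_iff.2 h
  · intro i j hij
    rcases lt_trichotomy (w i) (w j) with h | h | h
    · exact Or.inl (Or.inl h)
    · rcases lt_trichotomy (pos i) (pos j) with h' | h' | h'
      · exact Or.inl (Or.inr ⟨h, h'⟩)
      · exact absurd (hinj i j h h') hij
      · exact Or.inr (Or.inr ⟨h.symm, h'⟩)
    · exact Or.inr (Or.inl h)
  · intro i
    refine lt_of_lt_of_le ?_ (hD i)
    refine (mk_union_le {i' | w i' < w i} {i' | w i' = w i ∧ pos i' < pos i}).trans_lt
      (add_lt_of_lt (hw i) (hlt i) ?_)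
    refine lt_of_le_of_lt ?_ (lt_ord.1 (hpos i))
    rw [← mk_toType]
    refine mk_le_of_injective (f := fun i' => Ordinal.ToType.mk ⟨pos i', i'.2.2⟩) fun a b h => ?_
    have h' := Ordinal.ToType.mk.injective h
    exact Subtype.ext (hinj _ _ (a.2.1.trans b.2.1.symm) (congrArg Subtype.val h'))

/-- A family of elements of `Q`, regarded as a multiset. -/
abbrev Multi (Q : Type v) : Type (max (u + 1) v) := Σ I : Type u, I → Q

/-- The injective domination order on multisets. -/
def Multi.le (r : Q → Q → Prop) (M N : Multi.{u} Q) : Prop :=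
  ∃ ι : M.1 → N.1, Function.Injective ι ∧ ∀ i, r (M.2 i) (N.2 (ι i))

/-- The indices in a family with only finitely many elements above. -/
def Multi.fin (r : Q → Q → Prop) (M : Multi.{u} Q) : Set M.1 :=
  {i | upCard r M.2 i < ℵ₀}

open Classical in
/-- The list of elements of a family with only finitely many elements above. -/
noncomputable def Multi.finList (r : Q → Q → Prop) (M : Multi.{u} Q) : List Q :=
  if h : (M.fin r).Finite then h.toFinset.toList.map M.2 else []

theorem WqoFamily.fin_finite {r : Q → Q → Prop} {M : Multi.{u} Q} (h : WqoFamily r M.2) :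
    (M.fin r).Finite := by
  have := h.mk_upCard_lt le_rfl
  exact Cardinal.lt_aleph0_iff_set_finite.1 this

theorem exists_injective_of_sublistForall₂ {I J : Type*} {R : I → J → Prop} {l : List I}
    {l' : List J} (h : List.SublistForall₂ R l l') (hl : l.Nodup) (hl' : l'.Nodup) :
    ∃ g : {i // i ∈ l} → J, Function.Injective g ∧ ∀ i, g i ∈ l' ∧ R i.1 (g i) := by
  classical
  induction h with
  | nil => exact ⟨fun i => absurd i.2 List.not_mem_nil, fun i => absurd i.2 List.not_mem_nil,
      fun i => absurd i.2 List.not_mem_nil⟩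
  | @cons a b l l' hab _ ih =>
    rw [List.nodup_cons] at hl hl'
    obtain ⟨g, hg, hg'⟩ := ih hl.2 hl'.2
    have hmem : ∀ i : {i // i ∈ a :: l}, i.1 ≠ a → i.1 ∈ l := fun i hi =>
      (List.mem_cons.1 i.2).resolve_left hi
    refine ⟨fun i => if hi : i.1 = a then b else g ⟨i.1, hmem i hi⟩, ?_, ?_⟩
    · intro i j hij
      by_cases hi : i.1 = a <;> by_cases hj : j.1 = a
      · exact Subtype.ext (hi.trans hj.symm)
      · simp only [hi, hj, dif_pos, dif_neg, not_false_eq_true] at hij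
        exact absurd (hij ▸ (hg' _).1) hl'.1
      · simp only [hi, hj, dif_pos, dif_neg, not_false_eq_true] at hij
        exact absurd (hij ▸ (hg' _).1) hl'.1
      · simp only [hi, hj, dif_neg, not_false_eq_true] at hij
        exact Subtype.ext (congrArg (fun x => x.1) (hg hij))
    · intro i
      by_cases hi : i.1 = a
      · simp only [hi, dif_pos]
        exact ⟨List.mem_cons_self, hab⟩
      · simp only [hi, dif_neg, not_false_eq_true]
        exact ⟨List.mem_cons_of_mem _ (hg' _).1, (hg' ⟨i.1, hmem i hi⟩).2⟩
  | cons_right _ ih =>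
    rw [List.nodup_cons] at hl'
    obtain ⟨g, hg, hg'⟩ := ih hl hl'.2
    exact ⟨g, hg, fun i => ⟨List.mem_cons_of_mem _ (hg' i).1, (hg' i).2⟩⟩

theorem Multi.le_of_finList {r : Q → Q → Prop} (htr : ∀ a b c, r a b → r b c → r a c)
    {M N : Multi.{u} Q} (hM : WqoFamily r M.2) (hN : WqoFamily r N.2)
    (hfin : List.SublistForall₂ r (M.finList r) (N.finList r))
    (hinf : ∀ i, i ∉ M.fin r → ∃ j, r (M.2 i) (N.2 j) ∧ upCard r M.2 i ≤ upCard r N.2 j) :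
    Multi.le r M N := by
  classical
  have hMf := hM.fin_finite
  have hNf := hN.fin_finite
  rw [Multi.finList, Multi.finList, dif_pos hMf, dif_pos hNf,
    List.sublistForall₂_map_left_iff, List.sublistForall₂_map_right_iff] at hfin
  obtain ⟨g, hg, hg'⟩ := exists_injective_of_sublistForall₂ hfin (Finset.nodup_toList _)
    (Finset.nodup_toList _)
  have hmem : ∀ i, i ∈ M.fin r → i ∈ hMf.toFinset.toList := fun i hi => by simpa using hi
  have : Finite {i // i ∈ hMf.toFinset.toList} := (List.finite_toSet _).to_subtype
  have hex : ∃ ι : {i // i ∉ M.fin r} → N.1, Function.Injective ι ∧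
      ∀ i, ι i ∈ {j | r (M.2 i.1) (N.2 j)} \ Set.range g := by
    refine exists_injective_of_mk_le (fun i : {i // i ∉ M.fin r} => upCard r M.2 i.1)
      (fun i => not_lt.1 i.2)
      (fun i => ?_) (fun i => ?_) (fun i => {j | r (M.2 i.1) (N.2 j)} \ Set.range g) (fun i => ?_)
    · refine lt_of_le_of_lt ?_ (hM.mk_upCard_lt (not_lt.1 i.2))
      exact mk_le_of_injective (f := fun x => ⟨x.1.1, x.2⟩)
        fun a b h => Subtype.ext (Subtype.ext (Subtype.mk.inj h))
    · refine le_trans ?_ (hM.mk_upCard_le (not_lt.1 i.2))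
      exact mk_le_of_injective (f := fun x => ⟨x.1.1, x.2⟩)
        fun a b h => Subtype.ext (Subtype.ext (Subtype.mk.inj h))
    · obtain ⟨j, hij, hc⟩ := hinf i.1 i.2
      have hi : ℵ₀ ≤ upCard r M.2 i.1 := not_lt.1 i.2
      have h1 : upCard r M.2 i.1 ≤ #{j | r (M.2 i.1) (N.2 j)} :=
        hc.trans (mk_le_mk_of_subset fun k hk => htr _ _ _ hij hk)
      have h2 : #(Set.range g) < upCard r M.2 i.1 :=
        lt_of_lt_of_le (lt_aleph0_iff_set_finite.2 (Set.finite_range g)) hi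
      by_contra! h3
      refine h1.not_gt (lt_of_le_of_lt ?_ (add_lt_of_lt hi h3 h2))
      refine le_trans (mk_le_mk_of_subset ?_) (mk_union_le _ _)
      intro k hk
      by_cases h : k ∈ Set.range g
      · exact Or.inr h
      · exact Or.inl ⟨hk, h⟩
  obtain ⟨ι, hι, hι'⟩ := hex
  refine ⟨fun i => if hi : i ∈ M.fin r then g ⟨i, hmem i hi⟩ else ι ⟨i, hi⟩, ?_, ?_⟩
  · intro i j hij
    by_cases hi : i ∈ M.fin r <;> by_cases hj : j ∈ M.fin r
    · simp only [hi, hj, dif_pos] at hij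
      exact congrArg (fun x => x.1) (hg hij)
    · simp only [hi, hj, dif_pos, dif_neg, not_false_eq_true] at hij
      exact absurd ⟨_, hij⟩ (hι' ⟨j, hj⟩).2
    · simp only [hi, hj, dif_pos, dif_neg, not_false_eq_true] at hij
      exact absurd ⟨_, hij.symm⟩ (hι' ⟨i, hi⟩).2
    · simp only [hi, hj, dif_neg, not_false_eq_true] at hij
      exact congrArg Subtype.val (hι hij)
  · intro i
    by_cases hi : i ∈ M.fin r
    · simp only [hi, dif_pos]
      exact (hg' ⟨i, hmem i hi⟩).2
    · simp only [hi, dif_neg, not_false_eq_true]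
      exact (hι' ⟨i, hi⟩).1

open Arrays

/-- A bad array of multisets yields a bad array of members. -/
theorem Arrays.IsBad.exists_mem_multi {r : Q → Q → Prop} (htr : ∀ a b c, r a b → r b c → r a c)
    {F : Stream' ℕ → Multi.{u} Q} {A : List ℕ → Set ℕ} (hF : IsBad (Multi.le r) F A)
    (hwqo : ∀ X ∈ Br A, WqoFamily r (F X).2) :
    ∃ G B, IsBad r G B ∧ (∀ s, B s ⊆ A s) ∧ ∀ X ∈ Br B, G X ∈ Set.range (F X).2 := by
  classical
  obtain ⟨B, hB, hBA, hc | hc⟩ := ((hF.tame.prodMk hF.tame.tail).decided fun p =>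
    List.SublistForall₂ r (p.1.finList r) (p.2.finList r)).restrict hF.isSys
  · have hex : ∀ X ∈ Br B, ∃ i, ∀ j, r ((F X).2 i) ((F X.tail).2 j) →
        upCard r (F X.tail).2 j < upCard r (F X).2 i := by
      intro X hX
      by_contra! h
      exact hF.not_rel X (br_mono hBA hX) (Multi.le_of_finList htr (hwqo X (br_mono hBA hX))
        (hwqo _ (br_mono hBA (hB.tail_mem hX))) (hc X hX) fun i _ => h i)
    obtain ⟨X₀, hX₀⟩ := exists_mem_br hB.mem
    let q : Q := (F X₀).2 (hex X₀ hX₀).choose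
    let φ : Multi.{u} Q × Multi.{u} Q → Q × Cardinal.{u} := fun p =>
      if h : ∃ i, ∀ j, r (p.1.2 i) (p.2.2 j) → upCard r p.2.2 j < upCard r p.1.2 i then
        (p.1.2 h.choose, upCard r p.1.2 h.choose) else (q, 0)
    let G : Stream' ℕ → Q × Cardinal.{u} := fun X => φ (F X, F X.tail)
    have hG : Tame G := (hF.tame.prodMk hF.tame.tail).comp φ
    have hGF : ∀ X ∈ Br B, ∃ i, G X = ((F X).2 i, upCard r (F X).2 i) ∧
        ∀ j, r ((F X).2 i) ((F X.tail).2 j) →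
          upCard r (F X.tail).2 j < upCard r (F X).2 i := by
      intro X hX
      exact ⟨(hex X hX).choose, dif_pos (hex X hX), (hex X hX).choose_spec⟩
    obtain ⟨C, hC, hCB, hd | hd⟩ :=
      ((hG.prodMk hG.tail).decided fun p => r p.1.1 p.2.1).restrict hB
    · exfalso
      obtain ⟨X, hX⟩ := exists_mem_br hC.mem
      have hdrop : ∀ n, X.drop n ∈ Br C := by
        intro n
        induction n with
        | zero => exact hX
        | succ n ih => rw [← Stream'.tail_drop']; exact hC.tail_mem ih
      refine (RelEmbedding.natGT (r := ((· < ·) : Cardinal.{u} → Cardinal.{u} → Prop))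
        (fun n => (G (X.drop n)).2) fun n => ?_).not_wellFounded Cardinal.lt_wf
      obtain ⟨i, hi, hi'⟩ := hGF _ (br_mono hCB (hdrop n))
      obtain ⟨j, hj, -⟩ := hGF _ (br_mono hCB (hC.tail_mem (hdrop n)))
      have h1 := hd _ (hdrop n)
      simp only [hi, hj] at h1
      rw [← Stream'.tail_drop', hi, hj]
      exact hi' j h1
    · refine ⟨fun X => (G X).1, C, ⟨hG.comp Prod.fst, hC, hd⟩, fun s => (hCB s).trans (hBA s),
        fun X hX => ?_⟩
      obtain ⟨i, hi, -⟩ := hGF X (br_mono hCB hX)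
      exact ⟨i, (congrArg Prod.fst hi).symm⟩
  · have hbad : IsBad (List.SublistForall₂ r) (fun X => (F X).finList r) B :=
      ⟨hF.tame.comp _, hB, hc⟩
    obtain ⟨G, C, hG, hCB, hGF⟩ := hbad.exists_mem_list
    refine ⟨G, C, hG, fun s => (hCB s).trans (hBA s), fun X hX => ?_⟩
    have := hGF X hX
    rw [Multi.finList] at this
    split_ifs at this
    · obtain ⟨i, -, hi⟩ := List.mem_map.1 this
      exact ⟨i, hi⟩
    · exact absurd this List.not_mem_nil

end Multisets

section Rooted

open Arrays Relation

/-- The relation `r` has no bad sequence in the set `C`. -/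
def WqoOn {Q : Type*} (r : Q → Q → Prop) (C : Set Q) : Prop :=
  ∀ f : ℕ → Q, (∀ n, f n ∈ C) → ∃ a b, a < b ∧ r (f a) (f b)

theorem Arrays.BqoOn.wqoOn {Q : Type*} {r : Q → Q → Prop} {C : Set Q} (h : BqoOn r C) :
    WqoOn r C := h.exists_lt

/-- The relation on `Option Q` obtained by adding a largest element to `r`. -/
def topLe {Q : Type*} (r : Q → Q → Prop) : Option Q → Option Q → Prop
  | _, none => True
  | none, some _ => False
  | some x, some y => r x y

theorem topLe_trans {Q : Type*} {r : Q → Q → Prop} (hr : ∀ a b c, r a b → r b c → r a c) :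
    ∀ a b c, topLe r a b → topLe r b c → topLe r a c
  | _, _, none, _, _ => trivial
  | _, none, some _, _, h => h.elim
  | none, some _, some _, h, _ => h.elim
  | some a, some b, some c, h, h' => hr a b c h h'

/-- The set `C` with a largest element added. -/
def withTop {Q : Type*} (C : Set Q) : Set (Option Q) := {a | ∀ x, a = some x → x ∈ C}

theorem WqoOn.withTop {Q : Type*} {r : Q → Q → Prop} {C : Set Q} (h : WqoOn r C) :
    WqoOn (topLe r) (withTop C) := by
  intro f hf
  by_cases hn : ∃ n, f (n + 1) = none
  · obtain ⟨n, hn⟩ := hn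
    exact ⟨0, n + 1, Nat.succ_pos n, by rw [hn]; trivial⟩
  · push Not at hn
    have hs : ∀ n, ∃ x, f (n + 1) = some x := fun n => Option.ne_none_iff_exists'.1 (hn n)
    choose g hg using hs
    obtain ⟨a, b, hab, hr⟩ := h g fun n => hf _ _ (hg n)
    exact ⟨a + 1, b + 1, by omega, by rw [hg, hg]; exact hr⟩

theorem Arrays.IsBad.exists_of_topLe {Q : Type*} {r : Q → Q → Prop} {F : Stream' ℕ → Option Q}
    {A : List ℕ → Set ℕ} (hF : IsBad (topLe r) F A) :
    ∃ G B, IsBad r G B ∧ (∀ s, B s ⊆ A s) ∧ ∀ X ∈ Br B, F X = some (G X) := by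
  classical
  obtain ⟨B, hB, hBA, hc | hc⟩ := (hF.tame.decided fun a => a = none).restrict hF.isSys
  · obtain ⟨X, hX⟩ := exists_mem_br hB.mem
    exact absurd (by rw [hc _ (hB.tail_mem hX)]; trivial) (hF.not_rel X (br_mono hBA hX))
  · have hs : ∀ X ∈ Br B, ∃ x, F X = some x := fun X hX => Option.ne_none_iff_exists'.1 (hc X hX)
    obtain ⟨X₀, hX₀⟩ := exists_mem_br hB.mem
    let q := (hs X₀ hX₀).choose
    have hget : ∀ X ∈ Br B, F X = some ((F X).getD q) := by
      intro X hX
      obtain ⟨x, hx⟩ := hs X hX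
      rw [hx]
      rfl
    refine ⟨fun X => (F X).getD q, B, ⟨hF.tame.comp fun a => a.getD q, hB, fun X hX hr => ?_⟩,
      hBA, hget⟩
    refine hF.not_rel X (br_mono hBA hX) ?_
    rw [hget X hX, hget _ (hB.tail_mem hX)]
    exact hr

theorem Arrays.BqoOn.multi {Q : Type v} {r : Q → Q → Prop} {C : Set Q}
    (htr : ∀ a b c, r a b → r b c → r a c) (h : BqoOn r C) :
    BqoOn (Multi.le (topLe r)) {M : Multi.{u} (Option Q) | ∀ i, M.2 i ∈ withTop C} := by
  intro F A hF
  by_contra! hC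
  obtain ⟨G, B, hG, hBA, hGF⟩ := hF.exists_mem_multi (topLe_trans htr) fun X hX f => by
    exact h.wqoOn.withTop (fun n => (F X).2 (f n)) fun n => hC X hX (f n)
  obtain ⟨H, C', hH, hCB, hHG⟩ := hG.exists_of_topLe
  obtain ⟨X, hX, hXC⟩ := h H C' hH
  obtain ⟨i, hi⟩ := hGF X (br_mono hCB hX)
  exact hXC (hC X (br_mono (fun s => (hCB s).trans (hBA s)) hX) i _ (hi.trans (hHG X hX)))

variable {Ω : Type u} (child : Ω → Ω → Prop)

/-- `R` is a simulation: related nodes can be matched by descending on the right and injecting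
children into related children. -/
def IsSim (R : Ω → Ω → Prop) : Prop :=
  ∀ s t, R s t → ∃ t', ReflTransGen child t t' ∧
    ∃ ι : {c // child s c} → {c // child t' c}, Function.Injective ι ∧ ∀ c, R c.1 (ι c).1

/-- The embeddability relation between the rooted trees at two nodes. -/
def treeLe (s t : Ω) : Prop := ∃ R, IsSim child R ∧ R s t

/-- The strict descendants into which the tree does not embed. -/
def treeLt (s t : Ω) : Prop := ReflTransGen child t s ∧ ¬ treeLe child t s

variable {child}

theorem isSim_treeLe : IsSim child (treeLe child) := by
  rintro s t ⟨R, hR, h⟩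
  obtain ⟨t', ht', ι, hι, hι'⟩ := hR s t h
  exact ⟨t', ht', ι, hι, fun c => ⟨R, hR, hι' c⟩⟩

theorem treeLe_of_desc {s t : Ω} (h : ReflTransGen child t s) : treeLe child s t :=
  ⟨fun a b => ReflTransGen child b a, fun a _ h => ⟨a, h, id, fun _ _ h => h, fun _ => .refl⟩, h⟩

theorem treeLe_refl (s : Ω) : treeLe child s s := treeLe_of_desc .refl

theorem treeLe.trans_desc {s t u : Ω} (h : treeLe child s t) (h' : ReflTransGen child u t) :
    treeLe child s u := by
  obtain ⟨R, hR, h⟩ := h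
  refine ⟨fun a b => ∃ b', ReflTransGen child b b' ∧ R a b', ?_, t, h', h⟩
  rintro a b ⟨b', hb, hab⟩
  obtain ⟨c, hc, ι, hι, hι'⟩ := hR a b' hab
  exact ⟨c, hb.trans hc, ι, hι, fun x => ⟨_, .refl, hι' x⟩⟩

theorem treeLe.desc_trans {s t u : Ω} (h : ReflTransGen child t s) (h' : treeLe child t u) :
    treeLe child s u := by
  induction h with
  | refl => exact h'
  | @tail x y _ hxy ih =>
    obtain ⟨u', hu', ι, -, hι'⟩ := isSim_treeLe x u ih
    exact (hι' ⟨y, hxy⟩).trans_desc (hu'.tail (ι ⟨y, hxy⟩).2)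

theorem treeLe.trans {s t u : Ω} (h : treeLe child s t) (h' : treeLe child t u) :
    treeLe child s u := by
  refine ⟨fun a c => ∃ b, treeLe child a b ∧ treeLe child b c, ?_, t, h, h'⟩
  rintro a c ⟨b, hab, hbc⟩
  obtain ⟨b', hb', ι, hι, hι'⟩ := isSim_treeLe a b hab
  obtain ⟨c', hc', κ, hκ, hκ'⟩ := isSim_treeLe b' c (treeLe.desc_trans hb' hbc)
  exact ⟨c', hc', κ ∘ ι, hκ.comp hι, fun x => ⟨_, hι' x, hκ' _⟩⟩

theorem treeLt.trans {s t u : Ω} (h : treeLt child s t) (h' : treeLt child t u) :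
    treeLt child s u :=
  ⟨h'.1.trans h.1, fun hu => h.2 (treeLe.desc_trans h'.1 hu)⟩

theorem treeLt.le {s t : Ω} (h : treeLt child s t) : treeLe child s t := treeLe_of_desc h.1

variable (child) in
open Classical in
/-- The multiset of children of a node, where the children in `V` are replaced by a largest
element. -/
noncomputable def kind (V : Set Ω) (u : Ω) : Multi.{u} (Option Ω) :=
  ⟨{c // child u c}, fun c => if c.1 ∈ V then none else some c.1⟩

theorem kind_mem_withTop {V C : Set Ω} {u : Ω} (h : ∀ c, child u c → c ∉ V → c ∈ C) (i) :
    (kind child V u).2 i ∈ withTop C := by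
  intro x hx
  simp only [kind] at hx
  split_ifs at hx with hi
  obtain rfl := Option.some_injective _ hx
  exact h i.1 i.2 hi

theorem kind_congr {V W : Set Ω} {u : Ω} (h : ∀ c, child u c → (c ∈ V ↔ c ∈ W)) :
    kind child V u = kind child W u := by
  classical
  unfold kind
  congr 1
  funext c
  simp only [h c.1 c.2]

theorem kind_le_kind {U W : Set Ω} {u w : Ω} :
    Multi.le (topLe (treeLe child)) (kind child U u) (kind child W w) ↔
      ∃ ι : {c // child u c} → {c // child w c}, Function.Injective ι ∧
        ∀ c, (ι c).1 ∈ W ∨ c.1 ∉ U ∧ treeLe child c.1 (ι c).1 := by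
  refine exists_congr fun ι => and_congr_right fun _ => forall_congr' fun c => ?_
  simp only [kind]
  split_ifs with h1 h2 h2 <;> simp [topLe, h1, h2]

/-- The homogeneity criterion for embeddability. -/
theorem treeLe_of_kind {U W : Set Ω}
    (hL : ∀ u ∈ U, ∀ d, child u d → d ∉ U → ∀ w ∈ W, treeLe child d w)
    (hK : ∀ u ∈ U, ∀ w ∈ W, ∃ w', ReflTransGen child w w' ∧
      Multi.le (topLe (treeLe child)) (kind child U u) (kind child W w')) :
    ∀ u ∈ U, ∀ w ∈ W, treeLe child u w := by
  intro u hu w hw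
  refine ⟨fun a b => (a ∈ U ∧ b ∈ W) ∨ treeLe child a b, ?_, Or.inl ⟨hu, hw⟩⟩
  rintro a b (⟨ha, hb⟩ | h)
  · obtain ⟨w', hw', hι⟩ := hK a ha b hb
    obtain ⟨ι, hι, hι'⟩ := kind_le_kind.1 hι
    refine ⟨w', hw', ι, hι, fun c => ?_⟩
    rcases hι' c with h | h
    · by_cases hc : c.1 ∈ U
      · exact Or.inl ⟨hc, h⟩
      · exact Or.inr (hL a ha c.1 c.2 hc _ h)
    · exact Or.inr h.2
  · obtain ⟨t', ht', ι, hι, hι'⟩ := isSim_treeLe a b h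
    exact ⟨t', ht', ι, hι, fun c => Or.inr (hι' c)⟩

variable (child) in
/-- The descendants of a node into which the whole tree at this node embeds. -/
def upper (t : Ω) : Set Ω := {u | ReflTransGen child t u ∧ treeLe child t u}

/-- A tree is determined up to equivalence by its lower descendants and its kinds. -/
theorem treeLe_of_lower_of_kind {t s : Ω}
    (hL : ∀ d, treeLt child d t → ∃ d', treeLt child d' s ∧ treeLe child d d')
    (hK : ∀ u ∈ upper child t, ∃ w ∈ upper child s, Multi.le (topLe (treeLe child))
      (kind child (upper child t) u) (kind child (upper child s) w)) :
    treeLe child t s := by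
  refine treeLe_of_kind (U := upper child t) (W := upper child s) ?_ ?_ t ⟨.refl, treeLe_refl t⟩ s
    ⟨.refl, treeLe_refl s⟩
  · intro u hu d hud hd w hw
    have htd := hu.1.tail hud
    obtain ⟨d', hd', hdd'⟩ := hL d ⟨htd, fun h => hd ⟨htd, h⟩⟩
    exact hdd'.trans (hd'.le.trans hw.2)
  · intro u hu w hw
    obtain ⟨w', hw', hι⟩ := hK u hu
    obtain ⟨ι, hι, hι'⟩ := kind_le_kind.1 hι
    obtain ⟨w'', hw'', κ, hκ, hκ'⟩ := isSim_treeLe w' w (treeLe.desc_trans hw'.1 hw.2)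
    refine ⟨w'', hw'', kind_le_kind.2 ⟨κ ∘ ι, hκ.comp hι, fun c => ?_⟩⟩
    rcases hι' c with h | h
    · exact Or.inl ⟨(hw.1.trans hw'').tail (κ (ι c)).2, h.2.trans (hκ' _)⟩
    · exact Or.inr ⟨h.1, h.2.trans (hκ' _)⟩

theorem treeLt_of_kind_eq_some {t u : Ω} (hu : u ∈ upper child t) {i x}
    (hx : (kind child (upper child t) u).2 i = some x) : treeLt child x t := by
  refine kind_mem_withTop (C := {x | treeLt child x t}) (fun c hc hcu => ?_) i x hx
  have := hu.1.tail hc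
  exact ⟨this, fun h => hcu ⟨this, h⟩⟩

/-- A set of nodes closed under `treeLt` in which `treeLt` is well-founded and all sections are
well-quasi-ordered is better-quasi-ordered. -/
theorem bqoOn_of_forall_wqoOn {C : Set Ω} (hacc : ∀ t ∈ C, Acc (treeLt child) t)
    (hcl : ∀ t ∈ C, ∀ s, treeLt child s t → s ∈ C)
    (hwqo : ∀ t ∈ C, WqoOn (treeLe child) {s | treeLt child s t}) : BqoOn (treeLe child) C := by
  classical
  intro F A hF
  by_contra! hFC
  have hwf : WellFounded fun a b => treeLt child a b ∧ b ∈ C := by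
    refine ⟨fun b => ?_⟩
    by_cases hb : b ∈ C
    · exact Subrelation.accessible (fun h => h.1) (hacc b hb)
    · exact ⟨b, fun a h => absurd h.2 hb⟩
  obtain ⟨G, B, hG, hBA, hGF, hmin⟩ := exists_minimal_bad
    (l := fun a b => treeLt child a b ∧ b ∈ C)
    (fun a b c h h' => h.trans h'.1.le)
    (fun a b c h h' => ⟨h.1.trans h'.1, h'.2⟩) hwf hF
  have hGC : ∀ X ∈ Br B, G X ∈ C := by
    intro X hX
    have := hFC X (br_mono hBA hX)
    rcases hGF X with h | h
    · rwa [h]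
    · exact hcl _ this _ h.1
  have hmin' : ∀ H C', IsBad (treeLe child) H C' → (∀ s, C' s ⊆ B s) →
      ¬ ∀ X ∈ Br C', treeLt child (H X) (G X) := fun H C' hH hC' h =>
    hmin H C' hH hC' fun X hX => ⟨h X hX, hGC X (br_mono hC' hX)⟩
  let PL : Ω × Ω → Ω → Prop := fun p d => treeLt child d p.1 ∧
    ∀ d', treeLt child d' p.2 → ¬ treeLe child d d'
  let PK : Ω × Ω → Ω → Prop := fun p u => u ∈ upper child p.1 ∧ ∀ w ∈ upper child p.2,
    ¬ Multi.le (topLe (treeLe child)) (kind child (upper child p.1) u)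
      (kind child (upper child p.2) w)
  have hGG := hG.tame.prodMk hG.tame.tail
  obtain ⟨C', hC', hC'B, hc | hc⟩ := (hGG.decided fun p => ∃ d, PL p d).restrict hG.isSys
  · let φ : Ω × Ω → Ω := fun p => if h : ∃ d, PL p d then h.choose else p.1
    have hφ : ∀ X ∈ Br C', PL (G X, G X.tail) (φ (G X, G X.tail)) := by
      intro X hX
      simp only [φ, dif_pos (hc X hX)]
      exact (hc X hX).choose_spec
    refine hmin' (fun X => φ (G X, G X.tail)) C' ⟨hGG.comp φ, hC', fun X hX => ?_⟩ hC'B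
      fun X hX => (hφ X hX).1
    exact (hφ X hX).2 _ (hφ _ (hC'.tail_mem hX)).1
  · have hPK : ∀ X ∈ Br C', ∃ u, PK (G X, G X.tail) u := by
      intro X hX
      by_contra! h
      refine hG.not_rel X (br_mono hC'B hX) (treeLe_of_lower_of_kind ?_ ?_)
      · intro d hd
        by_contra! hd'
        exact hc X hX ⟨d, hd, hd'⟩
      · intro u hu
        by_contra! hu'
        exact h u ⟨hu, hu'⟩
    let φ : Ω × Ω → Ω := fun p => if h : ∃ u, PK p u then h.choose else p.1
    have hφ : ∀ X ∈ Br C', PK (G X, G X.tail) (φ (G X, G X.tail)) := by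
      intro X hX
      simp only [φ, dif_pos (hPK X hX)]
      exact (hPK X hX).choose_spec
    let K : Stream' ℕ → Multi.{u} (Option Ω) := fun X =>
      kind child (upper child (G X)) (φ (G X, G X.tail))
    have hK : IsBad (Multi.le (topLe (treeLe child))) K C' :=
      ⟨hGG.comp fun p => kind child (upper child p.1) (φ p), hC', fun X hX =>
        (hφ X hX).2 _ (hφ _ (hC'.tail_mem hX)).1⟩
    obtain ⟨H, D, hH, hDC, hHK⟩ := hK.exists_mem_multi (topLe_trans fun _ _ _ => treeLe.trans)
      fun X hX f => (hwqo _ (hGC X (br_mono hC'B hX))).withTop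
        (fun n => (K X).2 (f n)) fun n x hx => treeLt_of_kind_eq_some (hφ X hX).1 hx
    obtain ⟨H', E, hH', hED, hH'H⟩ := hH.exists_of_topLe
    refine hmin' H' E hH' (fun s => (hED s).trans ((hDC s).trans (hC'B s))) fun X hX => ?_
    obtain ⟨i, hi⟩ := hHK X (br_mono hED hX)
    exact treeLt_of_kind_eq_some (hφ X (br_mono (fun s => (hED s).trans (hDC s)) hX)).1
      (hi.trans (hH'H X hX))

theorem wqoOn_treeLt {t : Ω} (ht : Acc (treeLt child) t) :
    WqoOn (treeLe child) {s | treeLt child s t} := by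
  induction ht with
  | intro t ht ih =>
    exact (bqoOn_of_forall_wqoOn ht (fun s hs r hr => hr.trans hs) ih).wqoOn

theorem bqoOn_acc : BqoOn (treeLe child) {t | Acc (treeLt child) t} :=
  bqoOn_of_forall_wqoOn (fun _ ht => ht) (fun _ ht _ hs => ht.inv hs) fun _ ht => wqoOn_treeLt ht

/-- A decreasing family of sets in a well-quasi-order stabilizes up to domination. -/
theorem exists_stable {Q : Type*} {r : Q → Q → Prop} {C : Set Q} (h : WqoOn r C) {V : Set Ω}
    (S : Ω → Set Q) (hS : ∀ v w, ReflTransGen child v w → S w ⊆ S v)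
    (hSC : ∀ v, S v ⊆ C) {u : Ω} (hu : u ∈ V) :
    ∃ v ∈ V, ReflTransGen child u v ∧ ∀ w ∈ V, ReflTransGen child v w →
      ∀ x ∈ S v, ∃ y ∈ S w, r x y := by
  by_contra! hbad
  have hstep : ∀ v : {v // v ∈ V ∧ ReflTransGen child u v},
      ∃ w : {v // v ∈ V ∧ ReflTransGen child u v}, ReflTransGen child v.1 w.1 ∧
        ∃ x ∈ S v.1, ∀ y ∈ S w.1, ¬ r x y := by
    intro v
    obtain ⟨w, hw, hvw, hx⟩ := hbad v.1 v.2.1 v.2.2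
    exact ⟨⟨w, hw, v.2.2.trans hvw⟩, hvw, hx⟩
  choose next hnext x hx hx' using hstep
  let f : ℕ → {v // v ∈ V ∧ ReflTransGen child u v} := fun n => next^[n] ⟨u, hu, .refl⟩
  have hf : ∀ n, f (n + 1) = next (f n) := fun n => Function.iterate_succ_apply' _ _ _
  have hmono : ∀ m n, m ≤ n → ReflTransGen child (f m).1 (f n).1 := by
    intro m n hmn
    induction n, hmn using Nat.le_induction with
    | base => exact .refl
    | succ n _ ih => rw [hf]; exact ih.trans (hnext _)
  obtain ⟨a, b, hab, hr⟩ := h (fun n => x (f n)) fun n => hSC _ (hx _)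
  refine hx' (f a) _ (hS _ _ ?_ (hx (f b))) hr
  rw [← hf]
  exact hmono _ _ hab

theorem acc_treeLt (t : Ω) : Acc (treeLt child) t := by
  by_contra ht
  let V : Set Ω := {t | ¬ Acc (treeLt child) t}
  obtain ⟨v₁, hv₁, -, hL⟩ := exists_stable (child := child) bqoOn_acc.wqoOn (V := V)
    (fun v => {d | ReflTransGen child v d ∧ Acc (treeLt child) d})
    (fun v w hvw d hd => ⟨hvw.trans hd.1, hd.2⟩) (fun v d hd => hd.2) ht
  obtain ⟨v, hv, hv₁v, hK⟩ := exists_stable (child := child)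
    (bqoOn_acc (child := child).multi fun _ _ _ => treeLe.trans).wqoOn (V := V)
    (fun v => {k | ∃ u ∈ V, ReflTransGen child v u ∧ k = kind child V u})
    (fun v w hvw k ⟨u, hu, hwu, hk⟩ => ⟨u, hu, hvw.trans hwu, hk⟩)
    (fun v k ⟨u, hu, _, hk⟩ => by
      rw [hk]
      exact kind_mem_withTop fun c _ hc => not_not.1 hc) hv₁
  let W : Set Ω := {w | w ∈ V ∧ ReflTransGen child v w}
  have hkind : ∀ u, ReflTransGen child v u → kind child W u = kind child V u := fun u hu =>
    kind_congr fun c hc => ⟨fun h => h.1, fun h => ⟨h, hu.tail hc⟩⟩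
  have key : ∀ u ∈ W, ∀ w ∈ W, treeLe child u w := by
    refine treeLe_of_kind ?_ ?_
    · intro u hu d hud hd w hw
      have hvd := hu.2.tail hud
      have hdacc : Acc (treeLt child) d := by
        by_contra h
        exact hd ⟨h, hvd⟩
      obtain ⟨d', hd', hdd'⟩ := hL w hw.1 (hv₁v.trans hw.2) d ⟨hv₁v.trans hvd, hdacc⟩
      exact hdd'.trans_desc hd'.1
    · intro u hu w hw
      obtain ⟨k, ⟨w', hw', hww', rfl⟩, hle⟩ := hK w hw.1 hw.2 _ ⟨u, hu.1, hu.2, rfl⟩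
      refine ⟨w', hww', ?_⟩
      rwa [hkind u hu.2, hkind w' (hw.2.trans hww')]
  refine hv ⟨v, fun s hs => ?_⟩
  by_contra hsV
  exact hs.2 (key v ⟨hv, .refl⟩ s ⟨hsV, hs.1⟩)

theorem wellFounded_treeLt : WellFounded (treeLt child) := ⟨acc_treeLt⟩

theorem bqoOn_treeLe (C : Set Ω) : BqoOn (treeLe child) C := fun F A hF => by
  obtain ⟨X, -, hX⟩ := bqoOn_acc F A hF
  exact absurd (acc_treeLt _) hX

end Rooted

section Coding

open Cardinal Relation Arrays

variable {K : Type u} [Infinite K] {Q : Type*} {r : Q → Q → Prop} {C : Set Q}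

/-- The elements of `C` are classified up to `r` by a function into `K`. -/
def Coded (K : Type u) {Q : Type*} (r : Q → Q → Prop) (C : Set Q) : Prop :=
  ∃ f : Q → K, ∀ s ∈ C, ∀ t ∈ C, f s = f t → r s t

omit [Infinite K] in
theorem coded_of_mk_le {Y : Type u} (hY : #Y ≤ #K) (f : Q → Y)
    (hf : ∀ s ∈ C, ∀ t ∈ C, f s = f t → r s t) : Coded K r C := by
  obtain ⟨e⟩ := hY
  exact ⟨fun s => e (f s), fun s hs t ht h => hf s hs t ht (e.injective h)⟩

/-- Domination of sets. -/
def dom {Q : Type*} (r : Q → Q → Prop) (S T : Set Q) : Prop := ∀ x ∈ S, ∃ y ∈ T, r x y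

theorem Coded.dom (h : Coded K r C) (hC : WqoOn r C) (htr : ∀ a b c, r a b → r b c → r a c) :
    Coded K (dom r) {S | S ⊆ C} := by
  classical
  obtain ⟨f, hf⟩ := h
  have hbasis : ∀ S : Set Q, ∃ T : Finset Q, (∀ t ∈ T, t ∈ C ∧ ∀ y ∈ S, ¬ r t y) ∧
      ∀ x ∈ C, (∀ y ∈ S, ¬ r x y) → ∃ t ∈ T, r t x := by
    intro S
    have hw : WqoFamily r fun x : C => x.1 := fun g => hC (fun n => (g n).1) fun n => (g n).2
    obtain ⟨T, hT, hT'⟩ := hw.exists_finite_basis {x | ∀ y ∈ S, ¬ r x.1 y}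
    refine ⟨T.image Subtype.val, fun t ht => ?_, fun x hx hxS => ?_⟩
    · obtain ⟨x, hx, rfl⟩ := Finset.mem_image.1 ht
      exact ⟨x.2, hT x hx⟩
    · obtain ⟨t, ht, htx⟩ := hT' ⟨x, hx⟩ hxS
      exact ⟨t.1, Finset.mem_image_of_mem _ ht, htx⟩
  choose T hT hT' using hbasis
  refine coded_of_mk_le (mk_finset_of_infinite K).le (fun S => (T S).image f) ?_
  intro S hS S' hS' hSS' x hx
  by_contra! hxS'
  obtain ⟨t', ht', ht'x⟩ := hT' S' x (hS hx) hxS'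
  have h1 : f t' ∈ (T S).image f := by
    rw [show (T S).image f = (T S').image f from hSS']
    exact Finset.mem_image_of_mem _ ht'
  obtain ⟨t, ht, htt'⟩ := Finset.mem_image.1 h1
  exact (hT S t ht).2 x hx (htr _ _ _ (hf t (hT S t ht).1 t' (hT S' t' ht').1 htt') ht'x)

theorem Coded.list (h : Coded K r C) :
    Coded K (List.SublistForall₂ r) {l | ∀ x ∈ l, x ∈ C} := by
  obtain ⟨f, hf⟩ := h
  refine coded_of_mk_le (mk_list_eq_mk K).le (fun l => l.map f) ?_
  intro l
  induction l with
  | nil => exact fun _ _ _ _ => List.SublistForall₂.nil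
  | cons a l ih =>
    rintro hl (_ | ⟨b, l'⟩) hl' h
    · simp at h
    · rw [List.map_cons, List.map_cons, List.cons.injEq] at h
      exact List.SublistForall₂.cons
        (hf a (hl a List.mem_cons_self) b (hl' b List.mem_cons_self) h.1)
        (ih (fun x hx => hl x (List.mem_cons_of_mem _ hx)) l'
          (fun x hx => hl' x (List.mem_cons_of_mem _ hx)) h.2)

theorem Coded.withTop (h : Coded K r C) : Coded K (topLe r) (withTop C) := by
  obtain ⟨f, hf⟩ := h
  refine coded_of_mk_le (Y := Option K) ?_ (fun a => a.map f) ?_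
  · rw [mk_option, add_one_eq (aleph0_le_mk K)]
  · rintro (_ | s) hs (_ | t) ht h
    · trivial
    · simp at h
    · trivial
    · exact hf s (hs s rfl) t (ht t rfl) (Option.some_injective _ h)

/-- The product of `r` with the order on cardinals. -/
def cardLe {Q : Type*} (r : Q → Q → Prop) (a b : Q × Cardinal.{u}) : Prop :=
  r a.1 b.1 ∧ a.2 ≤ b.2

theorem WqoOn.cardLe (h : WqoOn r C) : WqoOn (cardLe.{u} r) {a | a.1 ∈ C} := by
  intro f hf
  obtain ⟨g, hg | hg⟩ := exists_increasing_or_nonincreasing_subseq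
    (fun a b : Cardinal.{u} => b < a) fun n => (f n).2
  · exact ((wellFounded_iff_isEmpty_descending_chain.1 Cardinal.lt_wf).false
      ⟨fun n => (f (g n)).2, fun n => hg n (n + 1) n.lt_succ_self⟩).elim
  · obtain ⟨a, b, hab, hr⟩ := h (fun n => (f (g n)).1) fun n => hf _
    exact ⟨g a, g b, g.strictMono hab, hr, not_lt.1 (hg a b hab)⟩

theorem Coded.cardLe {κ : Cardinal.{u}} (hK : #K = Order.succ κ) (h : Coded K r C) :
    Coded K (cardLe.{u} r) {a | a.1 ∈ C ∧ a.2 ≤ κ} := by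
  classical
  obtain ⟨f, hf⟩ := h
  have hY : #(K × (Order.succ κ).ord.ToType) ≤ #K := by
    rw [mk_prod, lift_id, lift_id, mk_ord_toType, ← hK, mul_eq_self (aleph0_le_mk K)]
  have hpos : (0 : Ordinal.{u}) < (Order.succ κ).ord := by
    rw [lt_ord, Ordinal.card_zero, ← hK]
    exact aleph0_pos.trans_le (aleph0_le_mk K)
  refine coded_of_mk_le hY (fun a => (f a.1, Ordinal.ToType.mk
    (if h : a.2.ord < (Order.succ κ).ord then ⟨a.2.ord, h⟩ else ⟨0, hpos⟩))) ?_
  intro s hs t ht hst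
  rw [Prod.mk.injEq] at hst
  refine ⟨hf _ hs.1 _ ht.1 hst.1, ?_⟩
  have h2 := Ordinal.ToType.mk.injective hst.2
  have hc : ∀ c ≤ κ, c.ord < (Order.succ κ).ord := fun c h => ord_lt_ord.2 (Order.lt_succ_iff.2 h)
  rw [dif_pos (hc _ hs.2), dif_pos (hc _ ht.2)] at h2
  exact (ord_injective (congrArg Subtype.val h2)).le

theorem Coded.multi {κ : Cardinal.{u}} (hK : #K = Order.succ κ) (h : Coded K r C)
    (hC : WqoOn r C) (htr : ∀ a b c, r a b → r b c → r a c) :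
    Coded K (Multi.le r) {M : Multi.{u} Q | (∀ i, M.2 i ∈ C) ∧ #M.1 ≤ κ} := by
  classical
  have hcC : WqoOn (_root_.cardLe.{u} r) {a | a.1 ∈ C ∧ a.2 ≤ κ} := fun f hf =>
    hC.cardLe f fun n => (hf n).1
  obtain ⟨f, hf⟩ := h.list
  obtain ⟨g, hg⟩ := (h.cardLe hK).dom hcC fun a b c hab hbc =>
    ⟨htr _ _ _ hab.1 hbc.1, hab.2.trans hbc.2⟩
  refine coded_of_mk_le (Y := K × K) (by simp) (fun M => (f (M.finList r),
    g {a | ∃ i ∉ M.fin r, a = (M.2 i, upCard r M.2 i)})) ?_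
  intro M hM N hN hMN
  rw [Prod.mk.injEq] at hMN
  have hw : ∀ M ∈ {M : Multi.{u} Q | (∀ i, M.2 i ∈ C) ∧ #M.1 ≤ κ}, WqoFamily r M.2 :=
    fun M hM e => hC (fun n => M.2 (e n)) fun n => hM.1 _
  have hfl : ∀ M ∈ {M : Multi.{u} Q | (∀ i, M.2 i ∈ C) ∧ #M.1 ≤ κ}, ∀ x ∈ M.finList r, x ∈ C := by
    intro M hM x hx
    rw [Multi.finList] at hx
    split_ifs at hx
    · obtain ⟨i, -, rfl⟩ := List.mem_map.1 hx
      exact hM.1 i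
    · simp at hx
  have hset : ∀ M ∈ {M : Multi.{u} Q | (∀ i, M.2 i ∈ C) ∧ #M.1 ≤ κ},
      {a | ∃ i ∉ M.fin r, a = (M.2 i, upCard r M.2 i)} ⊆ {a | a.1 ∈ C ∧ a.2 ≤ κ} := by
    rintro M hM _ ⟨i, -, rfl⟩
    exact ⟨hM.1 i, (mk_set_le _).trans hM.2⟩
  refine Multi.le_of_finList htr (hw M hM) (hw N hN) (hf _ (hfl M hM) _ (hfl N hN) hMN.1) ?_
  intro i hi
  obtain ⟨_, ⟨j, -, rfl⟩, hj⟩ := hg _ (hset M hM) _ (hset N hN) hMN.2 _ ⟨i, hi, rfl⟩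
  exact ⟨j, hj⟩

variable {Ω : Type u} {child : Ω → Ω → Prop}

theorem coded_of_forall_rank {ρ : Ω → Ordinal.{u}} {r : Ω → Ω → Prop} {β : Ordinal.{u}}
    (hβ : β ≤ (#K).ord) (h : ∀ γ < β, Coded K r {t | ρ t = γ}) : Coded K r {t | ρ t < β} := by
  classical
  choose f hf using h
  have hY : #((#K).ord.ToType × K) ≤ #K := by simp
  have hpos : (0 : Ordinal.{u}) < (#K).ord := by
    rw [lt_ord, Ordinal.card_zero]
    exact aleph0_pos.trans_le (aleph0_le_mk K)
  obtain ⟨k⟩ : Nonempty K := inferInstance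
  refine coded_of_mk_le hY (fun t => if h : ρ t < β then
    (Ordinal.ToType.mk ⟨ρ t, Set.mem_Iio.2 (h.trans_le hβ)⟩, f _ h t)
    else (Ordinal.ToType.mk ⟨0, hpos⟩, k)) ?_
  intro s (hs : ρ s < β) t (ht : ρ t < β) hst
  rw [dif_pos hs, dif_pos ht, Prod.mk.injEq] at hst
  have h1 : ρ s = ρ t := congrArg Subtype.val (Ordinal.ToType.mk.injective hst.1)
  refine hf (ρ s) hs s rfl t h1.symm ?_
  rw [hst.2]
  congr 1
  exact h1.symm ▸ rfl

theorem coded_rank_eq {κ : Cardinal.{u}} (hK : #K = Order.succ κ)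
    (hΩ : ∀ t, #{s | ReflTransGen child t s} ≤ κ) {ρ : Ω → Ordinal.{u}}
    (hρ : ∀ s t, treeLt child s t → ρ s < ρ t) {β : Ordinal.{u}}
    (h : Coded K (treeLe child) {t | ρ t < β}) : Coded K (treeLe child) {t | ρ t = β} := by
  have htr : ∀ a b c : Ω, treeLe child a b → treeLe child b c → treeLe child a c :=
    fun _ _ _ => treeLe.trans
  have hw : WqoOn (treeLe child) {t | ρ t < β} := (bqoOn_treeLe _).wqoOn
  obtain ⟨f, hf⟩ := h.dom hw htr
  have hm := (h.withTop.multi hK hw.withTop (topLe_trans htr)).dom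
    (fun F hF => ((bqoOn_treeLe {t | ρ t < β}).multi htr).wqoOn F fun n => (hF n).1) ?_
  · obtain ⟨g, hg⟩ := hm
    refine coded_of_mk_le (Y := K × K) (by simp) (fun t => (f {d | treeLt child d t},
      g (kind child (upper child t) '' upper child t))) ?_
    intro s hs t ht hst
    rw [Prod.mk.injEq] at hst
    have hL : ∀ s, ρ s = β → {d | treeLt child d s} ⊆ {t | ρ t < β} := by
      rintro s rfl d hd
      exact hρ _ _ hd
    have hKd : ∀ s, ρ s = β → kind child (upper child s) '' upper child s ⊆
        {M | (∀ i, M.2 i ∈ withTop {t | ρ t < β}) ∧ #M.1 ≤ κ} := by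
      rintro s hs _ ⟨u, hu, rfl⟩
      refine ⟨fun i x hx => hL s hs (treeLt_of_kind_eq_some hu hx), le_trans ?_ (hΩ u)⟩
      exact mk_le_mk_of_subset fun c hc => ReflTransGen.single hc
    refine treeLe_of_lower_of_kind (fun d hd => ?_) fun u hu => ?_
    · exact hf _ (hL s hs) _ (hL t ht) hst.1 d hd
    · obtain ⟨_, ⟨w, hw, rfl⟩, hle⟩ := hg _ (hKd s hs) _ (hKd t ht) hst.2 _ ⟨u, hu, rfl⟩
      exact ⟨w, hw, hle⟩
  · rintro a b c ⟨ι, hι, hι'⟩ ⟨κ, hκ, hκ'⟩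
    exact ⟨κ ∘ ι, hκ.comp hι, fun i => topLe_trans htr _ _ _ (hι' i) (hκ' _)⟩

theorem coded_treeLe {κ : Cardinal.{u}} (hκ : ℵ₀ ≤ κ) (hK : #K = Order.succ κ)
    (hΩ : ∀ t, #{s | ReflTransGen child t s} ≤ κ) :
    ∃ f : Ω → K, ∀ s t, f s = f t → treeLe child s t := by
  have : IsWellFounded Ω (treeLt child) := ⟨wellFounded_treeLt⟩
  let ρ := IsWellFounded.rank (treeLt child)
  have hρ : ∀ s t, treeLt child s t → ρ s < ρ t := fun s t h => IsWellFounded.rank_lt_of_rel h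
  have hlt : ∀ t, ρ t < (#K).ord := by
    intro t
    induction t using IsWellFounded.induction (treeLt child) with
    | ind t ih =>
    have hreg : (#K).IsRegular := hK ▸ isRegular_succ hκ
    change IsWellFounded.rank _ t < _
    rw [IsWellFounded.rank_eq]
    refine Ordinal.iSup_lt_of_lt_cof ?_ fun s => ?_
    · rw [hreg.cof_ord, hK, Order.lt_succ_iff]
      exact (mk_le_mk_of_subset fun s hs => hs.1).trans (hΩ t)
    · exact (isSuccLimit_ord hreg.1).succ_lt (ih _ s.2)
  have hle : ∀ β ≤ (#K).ord, Coded K (treeLe child) {t | ρ t < β} := by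
    intro β
    induction β using WellFoundedLT.induction with
    | ind β ih =>
    exact fun hβ => coded_of_forall_rank hβ fun γ hγ =>
      coded_rank_eq hK hΩ hρ (ih γ hγ (hγ.le.trans hβ))
  obtain ⟨f, hf⟩ := hle _ le_rfl
  exact ⟨f, fun s t => hf s (hlt s) t (hlt t)⟩

end Coding

section Rooting

open Relation

variable {V : Type*} {W : Type*}

/-- The graph `G` is the rooted tree with root `r`, parent function `p` and depth function `d`. -/
structure IsRooting (G : SimpleGraph V) (r : V) (p : V → V) (d : V → ℕ) : Prop where
  parent_root : p r = r
  depth_root : d r = 0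
  depth : ∀ v, v ≠ r → d v = d (p v) + 1
  adj_iff : ∀ a b, G.Adj a b ↔ a ≠ r ∧ p a = b ∨ b ≠ r ∧ p b = a

theorem SimpleGraph.IsTree.exists_isRooting {G : SimpleGraph V} (hG : G.IsTree) (r : V) :
    ∃ p d, IsRooting G r p d := by
  choose P hP hP' using fun v => hG.existsUnique_path r v
  have hr : P r = .nil := (hP' r _ SimpleGraph.Walk.IsPath.nil).symm
  have key : ∀ a b (h : G.Adj a b), a ∈ (P b).support →
      b ≠ r ∧ (P b).penultimate = a ∧ (P b).length = (P a).length + 1 := by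
    intro a b h ha
    have hc := hG.isAcyclic.path_concat (hP a) (hP b) h ha
    have hl : (P b).length = (P a).length + 1 := by
      rw [hc, SimpleGraph.Walk.length_concat]
    refine ⟨?_, by rw [hc, SimpleGraph.Walk.penultimate_concat], hl⟩
    rintro rfl
    rw [hr] at hl
    simp at hl
  have hpen : ∀ v, v ≠ r → G.Adj (P v).penultimate v := fun v hv =>
    (P v).adj_penultimate (SimpleGraph.Walk.not_nil_of_ne hv.symm)
  refine ⟨fun v => (P v).penultimate, fun v => (P v).length, ?_, ?_, ?_, ?_⟩
  · rw [hr]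
    rfl
  · rw [hr]
    rfl
  · intro v hv
    exact (key _ v (hpen v hv) (SimpleGraph.Walk.getVert_mem_support _ _)).2.2
  · intro a b
    constructor
    · intro h
      by_cases ha : a ∈ (P b).support
      · have := key a b h ha
        exact Or.inr ⟨this.1, this.2.1⟩
      · have := key b a h.symm
          (hG.isAcyclic.mem_support_of_ne_mem_support_of_adj_of_isPath (hP a) (hP b) h ha)
        exact Or.inl ⟨this.1, this.2.1⟩
    · rintro (⟨ha, rfl⟩ | ⟨hb, rfl⟩)
      · exact (hpen a ha).symm
      · exact hpen b hb

namespace IsRooting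

variable {G : SimpleGraph V} {r : V} {p : V → V} {d : V → ℕ} (h : IsRooting G r p d)

include h in
theorem adj_parent {v : V} (hv : v ≠ r) : G.Adj v (p v) := (h.adj_iff _ _).2 (Or.inl ⟨hv, rfl⟩)

end IsRooting

/-- The ancestor relation of a parent function. -/
def Anc (p : V → V) (a b : V) : Prop := ∃ n : ℕ, p^[n] b = a

theorem Anc.refl {p : V → V} (a : V) : Anc p a a := ⟨0, rfl⟩

theorem Anc.trans {p : V → V} {a b c : V} (hab : Anc p a b) (hbc : Anc p b c) : Anc p a c := by
  obtain ⟨n, rfl⟩ := hab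
  obtain ⟨m, rfl⟩ := hbc
  exact ⟨n + m, Function.iterate_add_apply _ _ _ _⟩

theorem Anc.parent {p : V → V} (a : V) : Anc p (p a) a := ⟨1, rfl⟩

theorem Anc.eq_or_parent {p : V → V} {a b : V} (h : Anc p a b) : a = b ∨ Anc p a (p b) := by
  obtain ⟨n, rfl⟩ := h
  cases n with
  | zero => exact Or.inl rfl
  | succ n => exact Or.inr ⟨n, rfl⟩

theorem Anc.total {p : V → V} {a b c : V} (ha : Anc p a c) (hb : Anc p b c) :
    Anc p a b ∨ Anc p b a := by
  obtain ⟨n, rfl⟩ := ha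
  obtain ⟨m, rfl⟩ := hb
  rcases le_total n m with h | h
  · obtain ⟨k, rfl⟩ := Nat.exists_eq_add_of_le' h
    exact Or.inr ⟨k, (Function.iterate_add_apply _ _ _ _).symm⟩
  · obtain ⟨k, rfl⟩ := Nat.exists_eq_add_of_le' h
    exact Or.inl ⟨k, (Function.iterate_add_apply _ _ _ _).symm⟩

namespace IsRooting

variable {G : SimpleGraph V} {r : V} {p : V → V} {d : V → ℕ} (h : IsRooting G r p d)
  {S : SimpleGraph W} {r' : W} {q : W → W} {e : W → ℕ} (h' : IsRooting S r' q e)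

include h in
theorem depth_parent_le (v : V) : d (p v) ≤ d v := by
  by_cases hv : v = r
  · rw [hv, h.parent_root]
  · rw [h.depth v hv]
    exact Nat.le_succ _

include h in
theorem depth_le {a b : V} (hab : Anc p a b) : d a ≤ d b := by
  obtain ⟨n, rfl⟩ := hab
  induction n with
  | zero => exact le_rfl
  | succ n ih =>
    rw [Function.iterate_succ_apply']
    exact (h.depth_parent_le _).trans ih

include h in
theorem anc_antisymm {a b : V} (hab : Anc p a b) (hd : d b ≤ d a) : a = b := by
  rcases hab.eq_or_parent with rfl | hab'
  · rfl
  · by_cases hb : b = r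
    · subst hb
      obtain ⟨n, rfl⟩ := hab
      exact Function.iterate_fixed h.parent_root n
    · have := h.depth_le hab'
      have := h.depth b hb
      omega

include h in
theorem anc_root (v : V) : Anc p r v := by
  induction hn : d v generalizing v with
  | zero =>
    by_cases hv : v = r
    · exact hv ▸ Anc.refl _
    · have := h.depth v hv
      omega
  | succ n ih =>
    have hv : v ≠ r := by
      rintro rfl
      have := h.depth_root
      omega
    exact (ih (p v) (by have := h.depth v hv; omega)).trans (Anc.parent v)

include h in
theorem exists_walk {a b : V} (hab : Anc p a b) :
    ∃ w : G.Walk b a, ∀ x ∈ w.support, Anc p a x ∧ Anc p x b := by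
  obtain ⟨n, hn⟩ := hab
  induction n generalizing b with
  | zero =>
    obtain rfl : b = a := hn
    refine ⟨.nil, fun x hx => ?_⟩
    rw [SimpleGraph.Walk.support_nil, List.mem_singleton] at hx
    exact hx ▸ ⟨Anc.refl _, Anc.refl _⟩
  | succ n ih =>
    obtain ⟨w, hw⟩ := ih (b := p b) hn
    by_cases hb : b = r
    · subst hb
      have he : p b = b := h.parent_root
      exact ⟨w.copy he rfl, by simpa [he] using hw⟩
    · refine ⟨.cons (h.adj_parent hb) w, fun x hx => ?_⟩
      rw [SimpleGraph.Walk.support_cons, List.mem_cons] at hx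
      rcases hx with rfl | hx
      · exact ⟨⟨n + 1, hn⟩, Anc.refl _⟩
      · exact ⟨(hw x hx).1, (hw x hx).2.trans (Anc.parent b)⟩

include h in
/-- A function on a rooted tree may be defined by recursion from the root. -/
theorem exists_rec {α : Type*} (a : α) (F : V → α → α) :
    ∃ σ : V → α, σ r = a ∧ ∀ c, c ≠ r → σ c = F c (σ (p c)) := by
  let g : ℕ → V → α := fun n => Nat.rec (fun _ => a) (fun _ g v => F v (g (p v))) n
  refine ⟨fun v => g (d v) v, ?_, fun c hc => ?_⟩
  · change g (d r) r = a
    rw [h.depth_root]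
    rfl
  · change g (d c) c = _
    rw [h.depth c hc]

include h in
theorem isTree : G.IsTree := by
  classical
  have hreach : ∀ v, G.Reachable v r := fun v => (h.exists_walk (h.anc_root v)).choose.reachable
  have : Nonempty V := ⟨r⟩
  refine ⟨⟨fun a b => (hreach a).trans (hreach b).symm⟩, fun v c hc => ?_⟩
  obtain ⟨u, hu, hmax⟩ := c.support.toFinset.exists_max_image d ⟨v, by simp⟩
  rw [List.mem_toFinset] at hu
  have hc' : (c.rotate u hu).IsCycle := hc.rotate hu
  have hpar : ∀ x ∈ (c.rotate u hu).support, G.Adj u x → x = p u := by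
    intro x hx hux
    have hx' : d x ≤ d u := hmax x (by simpa using hx)
    rcases (h.adj_iff _ _).1 hux with ⟨-, rfl⟩ | ⟨hxr, rfl⟩
    · rfl
    · have := h.depth x hxr
      omega
  refine hc'.snd_ne_penultimate ?_
  exact (hpar _ (SimpleGraph.Walk.getVert_mem_support _ _)
    (SimpleGraph.Walk.adj_snd hc'.not_nil)).trans
    (hpar _ (SimpleGraph.Walk.getVert_mem_support _ _)
      (SimpleGraph.Walk.adj_penultimate hc'.not_nil).symm).symm

section Embedding

variable {σ φ : V → W} (hσφ : ∀ v, Anc q (σ v) (φ v))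
  (hslot : ∀ c, c ≠ r → σ c ≠ r' ∧ q (σ c) = φ (p c))
  (hinj : ∀ c c', c ≠ r → c' ≠ r → p c = p c' → σ c = σ c' → c = c')

include hσφ hslot in
theorem slot_parent_anc {c : V} (hc : c ≠ r) : Anc q (σ (p c)) (σ c) :=
  (hσφ (p c)).trans ((hslot c hc).2 ▸ Anc.parent _)

include h h' hσφ hslot hinj in
theorem anc_of_slot_anc {v w : V} {x : W} (hv : Anc q (σ v) x) (hw : Anc q (σ w) x) :
    Anc p v w ∨ Anc p w v := by
  induction hn : d v + d w using Nat.strong_induction_on generalizing v w with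
  | _ n ih =>
  by_contra! hvw
  have hvr : v ≠ r := fun e => hvw.1 (e ▸ h.anc_root w)
  have hwr : w ≠ r := fun e => hvw.2 (e ▸ h.anc_root v)
  have hdv := h.depth v hvr
  have hdw := h.depth w hwr
  have h1 : Anc p (p v) w := (ih _ (by omega) ((slot_parent_anc hσφ hslot hvr).trans hv) hw
    rfl).resolve_right fun hh => hvw.2 (hh.trans (Anc.parent v))
  have h2 : Anc p (p w) v := (ih _ (by omega) hv ((slot_parent_anc hσφ hslot hwr).trans hw)
    rfl).resolve_left fun hh => hvw.1 (hh.trans (Anc.parent w))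
  have h3 : Anc p (p v) (p w) := h1.eq_or_parent.resolve_left fun e =>
    hvw.2 (e ▸ Anc.parent v)
  have h4 : Anc p (p w) (p v) := h2.eq_or_parent.resolve_left fun e =>
    hvw.1 (e ▸ Anc.parent w)
  have h5 : p v = p w := h.anc_antisymm h3 (h.depth_le h4)
  have h6 : e (σ v) = e (σ w) := by
    rw [h'.depth _ (hslot v hvr).1, h'.depth _ (hslot w hwr).1, (hslot v hvr).2, (hslot w hwr).2,
      h5]
  refine hvw.1 (hinj v w hvr hwr h5 ?_ ▸ Anc.refl _)
  rcases hv.total hw with hh | hh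
  · exact h'.anc_antisymm hh h6.ge
  · exact (h'.anc_antisymm hh h6.le).symm

include h h' hσφ hslot in
theorem eq_of_anc_of_slot_anc {v w : V} {x : W} (hvw : Anc p v w) (hv : Anc q x (φ v))
    (hw : Anc q (σ w) x) : v = w := by
  by_contra hne
  have hwr : w ≠ r := by
    rintro rfl
    exact hne (h.anc_antisymm hvw (h.depth_root ▸ Nat.zero_le _))
  have key : ∀ n w, w ≠ r → p^[n + 1] w = v → Anc q (φ v) (q (σ w)) := by
    intro n
    induction n with
    | zero =>
      rintro w hw rfl
      rw [(hslot w hw).2]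
      exact Anc.refl _
    | succ n ih =>
      intro w hw hwv
      rw [Function.iterate_succ_apply] at hwv
      rw [(hslot w hw).2]
      by_cases hpw : p w = r
      · rw [← hwv, hpw, Function.iterate_fixed h.parent_root]
        exact Anc.refl _
      · exact (ih _ hpw hwv).trans ((Anc.parent _).trans (hσφ _))
  obtain ⟨n, hn⟩ := hvw
  cases n with
  | zero => exact hne hn.symm
  | succ n =>
    have h1 := h'.depth_le (key n w hwr hn)
    have h2 := h'.depth _ (hslot w hwr).1
    have h3 := h'.depth_le hv
    have h4 := h'.depth_le hw
    omega

include h h' hσφ hslot hinj in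
theorem eq_of_mem_interval {v w : V} {x : W} (hv : Anc q (σ v) x ∧ Anc q x (φ v))
    (hw : Anc q (σ w) x ∧ Anc q x (φ w)) : v = w := by
  rcases h.anc_of_slot_anc h' hσφ hslot hinj hv.1 hw.1 with hvw | hwv
  · exact h.eq_of_anc_of_slot_anc h' hσφ hslot hvw hv.2 hw.1
  · exact (h.eq_of_anc_of_slot_anc h' hσφ hslot hwv hw.2 hv.1).symm

include h h' hσφ hslot hinj in
theorem topMinorLE : TopMinorLE G S := by
  classical
  have hdisj := @h.eq_of_mem_interval _ _ _ _ _ _ _ _ _ _ h' _ _ hσφ hslot hinj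
  have hφ : ∀ v, Anc q (σ v) (φ v) ∧ Anc q (φ v) (φ v) := fun v => ⟨hσφ v, Anc.refl _⟩
  choose P hP hP' using h'.isTree.existsUnique_path
  have hsymm : ∀ a b, P a b = (P b a).reverse := fun a b => (hP' a b _ (hP b a).reverse).symm
  have hchild : ∀ c, c ≠ r → ∀ x ∈ (P (φ c) (φ (p c))).support,
      x = φ (p c) ∨ Anc q (σ c) x ∧ Anc q x (φ c) := by
    intro c hc x hx
    obtain ⟨w, hw⟩ := h'.exists_walk (hσφ c)
    have hadj : S.Adj (σ c) (φ (p c)) := (h'.adj_iff _ _).2 (Or.inl (hslot c hc))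
    rw [← hP' _ _ _ (w.concat hadj).bypass_isPath] at hx
    have := SimpleGraph.Walk.support_bypass_subset_support _ hx
    rw [SimpleGraph.Walk.support_concat, List.mem_append,
      List.mem_singleton] at this
    exact this.symm.imp id (hw x)
  have hedge : ∀ a b, G.Adj a b → ∃ c, c ≠ r ∧ s(a, b) = s(c, p c) ∧
      ∀ x ∈ (P (φ a) (φ b)).support, x = φ (p c) ∨ Anc q (σ c) x ∧ Anc q x (φ c) := by
    intro a b hab
    rcases (h.adj_iff _ _).1 hab with ⟨ha, rfl⟩ | ⟨hb, rfl⟩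
    · exact ⟨a, ha, rfl, hchild a ha⟩
    · refine ⟨b, hb, Sym2.eq_swap, fun x hx => hchild b hb x ?_⟩
      rw [hsymm, SimpleGraph.Walk.support_reverse, List.mem_reverse] at hx
      exact hx
  have hends : ∀ {a b c : V}, s(a, b) = s(c, p c) →
      ∀ x, x = φ c ∨ x = φ (p c) → x = φ a ∨ x = φ b := by
    intro a b c he x hx
    rcases Sym2.eq_iff.1 he with ⟨rfl, rfl⟩ | ⟨rfl, rfl⟩
    · exact hx
    · exact hx.symm
  refine ⟨⟨φ, ?_, fun a b _ => P (φ a) (φ b), fun a b _ => hP _ _, fun a b _ => hsymm _ _, ?_, ?_⟩⟩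
  · intro v w hvw
    refine hdisj (hφ v) ?_
    rw [hvw]
    exact hφ w
  · intro a b hab w hw hwa hwb x hxw
    obtain ⟨c, -, hce, hcs⟩ := hedge a b hab
    have hn : ¬ (w = φ c ∨ w = φ (p c)) := fun hh => (hends hce w hh).elim hwa hwb
    rcases hcs w hw with hh | hh
    · exact hn (Or.inr hh)
    · subst hxw
      exact hn (Or.inl (congrArg φ (hdisj (hφ x) hh)))
  · intro a b a' b' hab hab' hne w hw hw'
    obtain ⟨c, -, hce, hcs⟩ := hedge a b hab
    obtain ⟨c', -, hce', hcs'⟩ := hedge a' b' hab'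
    refine hends hce w ?_
    rcases hcs w hw with hh | hh
    · exact Or.inr hh
    · rcases hcs' w hw' with hh' | hh'
      · subst hh'
        exact Or.inl (congrArg φ (hdisj (hφ _) hh))
      · obtain rfl := hdisj hh hh'
        exact absurd (hce.trans hce'.symm) hne

end Embedding

end IsRooting

end Rooting

section UpperBound

open Relation Cardinal

variable {V : Type u} {r : V} {p : {G : SimpleGraph V // G.IsTree} → V → V}

/-- The child relation on the trees with a distinguished vertex, each tree being rooted at `r`. -/
def nodeChild (r : V) (p : {G : SimpleGraph V // G.IsTree} → V → V)
    (a b : {G : SimpleGraph V // G.IsTree} × V) : Prop :=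
  a.1 = b.1 ∧ b.2 ≠ r ∧ p a.1 b.2 = a.2

theorem anc_of_nodeChild {a b : {G : SimpleGraph V // G.IsTree} × V}
    (h : ReflTransGen (nodeChild r p) a b) : a.1 = b.1 ∧ Anc (p a.1) a.2 b.2 := by
  induction h with
  | refl => exact ⟨rfl, Anc.refl _⟩
  | tail _ hbc ih =>
    refine ⟨ih.1.trans hbc.1, ih.2.trans ?_⟩
    rw [ih.1, ← hbc.2.2]
    exact Anc.parent _

theorem topMinorLE_of_treeLe {d : {G : SimpleGraph V // G.IsTree} → V → ℕ}
    (hp : ∀ G, IsRooting G.1 r (p G) (d G)) {T S : {G : SimpleGraph V // G.IsTree}}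
    (h : treeLe (nodeChild r p) (T, r) (S, r)) : TopMinorLE T.1 S.1 := by
  have hstep : ∀ v t : V, ∃ (u : V) (g : V → V), treeLe (nodeChild r p) (T, v) (S, t) →
      Anc (p S) t u ∧ (∀ c, c ≠ r → p T c = v →
        g c ≠ r ∧ p S (g c) = u ∧ treeLe (nodeChild r p) (T, c) (S, g c)) ∧
      ∀ c c', c ≠ r → c' ≠ r → p T c = v → p T c' = v → g c = g c' → c = c' := by
    intro v t
    by_cases h : treeLe (nodeChild r p) (T, v) (S, t)
    · obtain ⟨⟨S', u⟩, hu, ι, hι, hι'⟩ := isSim_treeLe _ _ h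
      obtain ⟨hS, hu⟩ := anc_of_nodeChild hu
      obtain rfl : S = S' := hS
      classical
      let g : V → V := fun c => if hc : c ≠ r ∧ p T c = v then (ι ⟨(T, c), rfl, hc⟩).1.2 else t
      have hg : ∀ c (hc : c ≠ r) (hcv : p T c = v),
          (S, g c) = (ι ⟨(T, c), rfl, hc, hcv⟩).1 := by
        intro c hc hcv
        simp only [g, dif_pos (And.intro hc hcv)]
        exact Prod.ext (ι ⟨(T, c), rfl, hc, hcv⟩).2.1 rfl
      refine ⟨u, g, fun _ => ⟨hu, fun c hc hcv => ?_, fun c c' hc hc' hcv hcv' hgg => ?_⟩⟩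
      · have h1 := (ι ⟨(T, c), rfl, hc, hcv⟩).2
        have h2 := hι' ⟨(T, c), rfl, hc, hcv⟩
        rw [← hg c hc hcv] at h1 h2
        exact ⟨h1.2.1, h1.2.2, h2⟩
      · have := hι (Subtype.ext ((hg c hc hcv).symm.trans
          ((congrArg (Prod.mk S) hgg).trans (hg c' hc' hcv'))))
        exact congrArg (fun x => x.1.2) this
    · exact ⟨t, id, fun h' => absurd h' h⟩
  choose u g hg using hstep
  obtain ⟨σ, hσr, hσ⟩ := (hp T).exists_rec r fun c t => g (p T c) t c
  have hle : ∀ v, treeLe (nodeChild r p) (T, v) (S, σ v) := by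
    intro v
    induction hn : d T v generalizing v with
    | zero =>
      by_cases hv : v = r
      · rw [hv, hσr]
        exact h
      · have := (hp T).depth v hv
        omega
    | succ n ih =>
      have hv : v ≠ r := by
        rintro rfl
        have := (hp T).depth_root
        omega
      rw [hσ v hv]
      exact ((hg _ _ (ih (p T v) (by have := (hp T).depth v hv; omega))).2.1 v hv rfl).2.2
  refine (hp T).topMinorLE (hp S) (σ := σ) (φ := fun v => u v (σ v))
    (fun v => (hg _ _ (hle v)).1) (fun c hc => ?_) fun c c' hc hc' hcc hσσ => ?_
  · have := (hg _ _ (hle (p T c))).2.1 c hc rfl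
    rw [hσ c hc]
    exact ⟨this.1, this.2.1⟩
  · refine (hg _ _ (hle (p T c))).2.2 c c' hc hc' rfl hcc.symm ?_
    rw [← hσ c hc, hσσ, hσ c' hc', hcc]

theorem mk_topologicalTypes_le (hV : ℵ₀ ≤ #V) :
    #(Quot fun (T S : {G : SimpleGraph V // G.IsTree}) => TopEquiv T.1 S.1) ≤
      Order.succ #V := by
  obtain ⟨r⟩ : Nonempty V := mk_ne_zero_iff.1 (aleph0_pos.trans_le hV).ne'
  choose p d hp using fun G : {G : SimpleGraph V // G.IsTree} => G.2.exists_isRooting r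
  have hK : #(Order.succ #V).ord.ToType = Order.succ #V := mk_ord_toType _
  have : Infinite (Order.succ #V).ord.ToType := by
    rw [infinite_iff, hK]
    exact hV.trans (Order.le_succ _)
  have hΩ : ∀ t, #{s | ReflTransGen (nodeChild r p) t s} ≤ #V := fun t =>
    mk_le_of_injective (f := fun s => s.1.2) fun a b hab =>
      Subtype.ext (Prod.ext ((anc_of_nodeChild a.2).1.symm.trans (anc_of_nodeChild b.2).1) hab)
  obtain ⟨f, hf⟩ := coded_treeLe hV hK hΩ
  rw [← hK]
  refine mk_le_of_injective (f := fun q => f (q.out, r)) fun a b hab => ?_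
  rw [← Quot.out_eq a, ← Quot.out_eq b]
  exact Quot.sound ⟨topMinorLE_of_treeLe hp (hf _ _ hab), topMinorLE_of_treeLe hp (hf _ _ hab.symm)⟩

end UpperBound

section Derived

variable {V : Type*} {W : Type*} {H : SimpleGraph V} {G : SimpleGraph W}

namespace SimpleGraph.Walk.IsPath

theorem append_of_disjoint {a b c : V} {p : H.Walk a b} {q : H.Walk b c} (hp : p.IsPath)
    (hq : q.IsPath) (h : ∀ x ∈ p.support, x ∈ q.support → x = b) : (p.append q).IsPath := by
  rw [isPath_def, support_append, List.nodup_append']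
  have hq' := hq.support_nodup
  rw [← cons_tail_support, List.nodup_cons] at hq'
  refine ⟨hp.support_nodup, hq'.2, fun x hx hx' => ?_⟩
  have := h x hx (List.mem_of_mem_tail hx')
  exact hq'.1 (this ▸ hx')

end SimpleGraph.Walk.IsPath

theorem TopMinorEmb.exists_isPath (e : TopMinorEmb H G) {a b : V} (w : H.Walk a b)
    (hw : w.IsPath) : ∃ w' : G.Walk (e.toFun a) (e.toFun b), w'.IsPath ∧
      (∀ v ∈ w.support, e.toFun v ∈ w'.support) ∧
      ∀ z ∈ w'.support, (∃ v ∈ w.support, e.toFun v = z) ∨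
        ∃ c d, ∃ h : H.Adj c d, c ∈ w.support ∧ d ∈ w.support ∧ z ∈ (e.path h).support := by
  induction w with
  | nil =>
    refine ⟨.nil, .nil, ?_, ?_⟩
    · intro v hv
      rw [SimpleGraph.Walk.support_nil, List.mem_singleton] at hv
      simp [hv]
    · intro z hz
      rw [SimpleGraph.Walk.support_nil, List.mem_singleton] at hz
      exact Or.inl ⟨_, SimpleGraph.Walk.start_mem_support _, hz.symm⟩
  | @cons a a' b h w ih =>
    rw [SimpleGraph.Walk.cons_isPath_iff] at hw
    obtain ⟨w', hp, hmem, hsup⟩ := ih hw.1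
    have hdisj : ∀ x ∈ (e.path h).support, x ∈ w'.support → x = e.toFun a' := by
      intro x hx hx'
      have hne : x ≠ e.toFun a := by
        rintro rfl
        rcases hsup _ hx' with ⟨v, hv, hve⟩ | ⟨c, d, k, hc, hd, hk⟩
        · exact hw.2 (e.inj hve ▸ hv)
        · exact e.internal_avoid_image k _ hk (fun hh => hw.2 (e.inj hh ▸ hc))
            (fun hh => hw.2 (e.inj hh ▸ hd)) a rfl
      by_contra hne'
      rcases hsup _ hx' with ⟨v, hv, hve⟩ | ⟨c, d, k, hc, hd, hk⟩
      · exact e.internal_avoid_image h _ hx hne hne' v hve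
      · have hs : s(a, a') ≠ s(c, d) := by
          intro hs
          rcases Sym2.mem_iff.1 (hs ▸ Sym2.mem_mk_left a a' : a ∈ s(c, d)) with rfl | rfl
          · exact hw.2 hc
          · exact hw.2 hd
        exact (e.internally_disjoint h k hs x hx hk).elim hne hne'
    refine ⟨(e.path h).append w', (e.path_isPath h).append_of_disjoint hp hdisj, ?_, ?_⟩
    · intro v hv
      rw [SimpleGraph.Walk.mem_support_append_iff]
      rw [SimpleGraph.Walk.support_cons, List.mem_cons] at hv
      rcases hv with rfl | hv
      · exact Or.inl (SimpleGraph.Walk.start_mem_support _)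
      · exact Or.inr (hmem v hv)
    · intro z hz
      rw [SimpleGraph.Walk.mem_support_append_iff] at hz
      rw [SimpleGraph.Walk.support_cons]
      rcases hz with hz | hz
      · exact Or.inr ⟨a, a', h, List.mem_cons_self,
          List.mem_cons_of_mem _ (SimpleGraph.Walk.start_mem_support _), hz⟩
      · rcases hsup z hz with ⟨v, hv, hve⟩ | ⟨c, d, k, hc, hd, hk⟩
        · exact Or.inl ⟨v, List.mem_cons_of_mem _ hv, hve⟩
        · exact Or.inr ⟨c, d, k, List.mem_cons_of_mem _ hc, List.mem_cons_of_mem _ hd, hk⟩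

/-- The derived sets of a graph: a vertex lies in the `α`-th one if for every `β < α` it is an
interior vertex of a path between two vertices of the `β`-th one. -/
def SimpleGraph.derived (G : SimpleGraph W) (α : Ordinal.{u}) : Set W :=
  {v | ∀ β, β < α → ∃ x ∈ G.derived β, ∃ y ∈ G.derived β, x ≠ v ∧ y ≠ v ∧
    ∃ w : G.Walk x y, w.IsPath ∧ v ∈ w.support}
termination_by α

theorem SimpleGraph.mem_derived {α : Ordinal.{u}} {v : W} : v ∈ G.derived α ↔
    ∀ β, β < α → ∃ x ∈ G.derived β, ∃ y ∈ G.derived β, x ≠ v ∧ y ≠ v ∧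
      ∃ w : G.Walk x y, w.IsPath ∧ v ∈ w.support := by
  rw [derived]
  rfl

theorem TopMinorEmb.map_mem_derived (e : TopMinorEmb H G) (α : Ordinal.{u}) {v : V}
    (hv : v ∈ H.derived α) : e.toFun v ∈ G.derived α := by
  induction α using WellFoundedLT.induction generalizing v with
  | ind α ih =>
    rw [SimpleGraph.mem_derived] at hv ⊢
    intro β hβ
    obtain ⟨x, hx, y, hy, hxv, hyv, w, hw, hvw⟩ := hv β hβ
    obtain ⟨w', hp, hmem, -⟩ := e.exists_isPath w hw
    exact ⟨_, ih β hβ hx, _, ih β hβ hy, e.inj.ne hxv, e.inj.ne hyv, w', hp, hmem v hvw⟩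

theorem TopEquiv.derived_nonempty_iff (h : TopEquiv H G) (α : Ordinal.{u}) :
    (H.derived α).Nonempty ↔ (G.derived α).Nonempty := by
  obtain ⟨⟨e⟩, ⟨f⟩⟩ := h
  exact ⟨fun ⟨v, hv⟩ => ⟨_, e.map_mem_derived α hv⟩, fun ⟨v, hv⟩ => ⟨_, f.map_mem_derived α hv⟩⟩

namespace IsRooting

variable {r : V} {p : V → V} {d : V → ℕ} (h : IsRooting H r p d) {ρ : V → Ordinal.{u}}
  (hρ : ∀ v, v ≠ r → ρ v < ρ (p v))

include h in
theorem parent_mem_support {v x : V} (w : H.Walk x v) (hx : ¬ Anc p v x) : p v ∈ w.support := by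
  induction w with
  | nil => exact (hx (Anc.refl _)).elim
  | @cons x y v hxy w ih =>
    rw [SimpleGraph.Walk.support_cons]
    by_cases hy : Anc p v y
    · rcases (h.adj_iff x y).1 hxy with ⟨-, hp⟩ | ⟨-, hp⟩
      · exact (hx (hy.trans (hp ▸ Anc.parent x))).elim
      · rcases hy.eq_or_parent with rfl | hy
        · rw [hp]
          exact List.mem_cons_self
        · exact (hx (hp ▸ hy)).elim
    · exact List.mem_cons_of_mem _ (ih hy)

include h in
theorem anc_or_anc {v x y : V} (w : H.Walk x y) (hw : w.IsPath) (hv : v ∈ w.support) :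
    Anc p v x ∨ Anc p v y := by
  by_contra hh
  push Not at hh
  have hvr : v ≠ r := fun hvr => hh.1 (hvr ▸ h.anc_root x)
  obtain ⟨w₁, w₂, rfl⟩ := SimpleGraph.Walk.mem_support_iff_exists_append.1 hv
  refine hw.ne_of_mem_support_of_append (h.adj_parent hvr).ne.symm
    (h.parent_mem_support w₁ hh.1) ?_ rfl
  have := h.parent_mem_support w₂.reverse hh.2
  rwa [SimpleGraph.Walk.support_reverse, List.mem_reverse] at this

include h hρ in
theorem rank_lt_of_anc {a b : V} (hab : Anc p a b) : a = b ∨ ρ b < ρ a := by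
  obtain ⟨n, hn⟩ := hab
  induction n generalizing b with
  | zero => exact Or.inl hn.symm
  | succ n ih =>
    by_cases hb : b = r
    · subst hb
      rw [Function.iterate_fixed h.parent_root] at hn
      exact Or.inl hn.symm
    · refine Or.inr ?_
      rcases ih hn with hh | hh
      · exact hh ▸ hρ b hb
      · exact (hρ b hb).trans hh

include h hρ in
theorem le_rank_of_mem_derived {v : V} {γ : Ordinal.{u}} (hv : v ∈ H.derived γ) : γ ≤ ρ v := by
  induction hβ : ρ v using WellFoundedLT.induction generalizing v γ with
  | ind β ih =>
    by_contra! hlt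
    obtain ⟨x, hx, y, hy, hxv, hyv, w, hw, hvw⟩ := SimpleGraph.mem_derived.1 hv β hlt
    rcases h.anc_or_anc w hw hvw with ha | ha
    · have := (h.rank_lt_of_anc hρ ha).resolve_left hxv.symm
      exact (ih _ (hβ ▸ this) hx rfl).not_gt (hβ ▸ this)
    · have := (h.rank_lt_of_anc hρ ha).resolve_left hyv.symm
      exact (ih _ (hβ ▸ this) hy rfl).not_gt (hβ ▸ this)

include h hρ in
theorem derived_nonempty_iff
    (hc : ∀ v, ∀ β < ρ v, ∃ c c', c ≠ c' ∧ c ≠ r ∧ c' ≠ r ∧ p c = v ∧ p c' = v ∧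
      ρ c = β ∧ ρ c' = β) (γ : Ordinal.{u}) : (H.derived γ).Nonempty ↔ γ ≤ ρ r := by
  constructor
  · rintro ⟨v, hv⟩
    refine (h.le_rank_of_mem_derived hρ hv).trans ?_
    rcases h.rank_lt_of_anc hρ (h.anc_root v) with rfl | hh
    · exact le_rfl
    · exact hh.le
  · intro hγ
    refine ⟨r, ?_⟩
    generalize r = v at hγ
    induction γ using WellFoundedLT.induction generalizing v with
    | ind γ ih =>
      rw [SimpleGraph.mem_derived]
      intro β hβ
      obtain ⟨c, c', hne, hcr, hcr', rfl, hpc, hρc, hρc'⟩ := hc v β (hβ.trans_le hγ)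
      have h₁ := h.adj_parent hcr
      have h₂ := h.adj_parent hcr'
      rw [hpc] at h₂
      refine ⟨c, ih β hβ c hρc.ge, c', ih β hβ c' hρc'.ge, h₁.ne, h₂.ne,
        .cons h₁ (.cons h₂.symm .nil), ?_, ?_⟩
      · simp [SimpleGraph.Walk.cons_isPath_iff, hne, h₁.ne, h₂.ne.symm]
      · simp

end IsRooting

end Derived

section LowerBound

open Cardinal

variable {V : Type u}

theorem exists_rank_tree (hV : ℵ₀ ≤ #V) (α : Ordinal.{u}) (hα : α.card = #V) :
    ∃ G : SimpleGraph V, G.IsTree ∧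
      ∀ γ : Ordinal.{u}, (G.derived γ).Nonempty ↔ γ ≤ α := by
  let X := {l : List (α.ToType × Bool) // l.Pairwise fun a b => a.1 < b.1}
  have hA : #(α.ToType) = #V := by rw [mk_toType, hα]
  have hAinf : Infinite α.ToType := infinite_iff.2 (hA ▸ hV)
  have hX : #X = #V := by
    apply le_antisymm
    · refine (mk_subtype_le _).trans ?_
      rw [mk_list_eq_mk, mk_prod, lift_uzero, hA]
      exact mul_le_of_le hV le_rfl ((lift_le_aleph0.2 mk_le_aleph0).trans hV)
    · rw [← hA]
      refine mk_le_of_injective (f := fun a => (⟨[(a, true)], List.pairwise_singleton _ _⟩ : X)) ?_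
      intro a b hab
      simpa using congrArg (fun x => x.1) hab
  obtain ⟨e⟩ := Cardinal.eq.1 hX
  let p₀ : X → X := fun l => ⟨l.1.tail, l.2.tail⟩
  let v₀ : α.ToType → Ordinal.{u} := fun a => (Ordinal.ToType.mk.symm a).1
  let ρ₀ : List (α.ToType × Bool) → Ordinal.{u} := fun l => (l.head?.map fun a => v₀ a.1).getD α
  let r : V := e ⟨[], List.Pairwise.nil⟩
  let p : V → V := fun v => e (p₀ (e.symm v))
  let d : V → ℕ := fun v => (e.symm v).1.length
  let ρ : V → Ordinal.{u} := fun v => ρ₀ (e.symm v).1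
  have hv₀ : ∀ {a b}, a < b → v₀ a < v₀ b := fun hab =>
    Subtype.coe_lt_coe.2 (Ordinal.ToType.mk.symm.lt_iff_lt.2 hab)
  have hcons : ∀ v, v ≠ r → ∃ a l, ∃ h, e.symm v = ⟨a :: l, h⟩ := by
    intro v hv
    rcases he : e.symm v with ⟨l, hl⟩
    cases l with
    | nil =>
      refine (hv ?_).elim
      rw [← e.apply_symm_apply v, he]
    | cons a l => exact ⟨a, l, hl, rfl⟩
  have hd : ∀ v, v ≠ r → d v = d (p v) + 1 := by
    intro v hv
    obtain ⟨a, l, hl, he⟩ := hcons v hv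
    simp [d, p, p₀, he]
  have hpr : p r = r := by simp [p, p₀, r]
  let G : SimpleGraph V :=
    { Adj := fun a b => a ≠ r ∧ p a = b ∨ b ≠ r ∧ p b = a
      symm := ⟨fun a b h => h.symm⟩
      loopless := ⟨fun a h => by
        rcases h with ⟨h, h'⟩ | ⟨h, h'⟩ <;>
        · have := hd a h
          rw [h'] at this
          omega⟩ }
  have hG : IsRooting G r p d := ⟨hpr, by simp [d, r], hd, fun a b => Iff.rfl⟩
  have hρr : ρ r = α := by simp [ρ, ρ₀, r]
  refine ⟨G, hG.isTree, fun γ => ?_⟩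
  rw [← hρr]
  refine hG.derived_nonempty_iff ?_ ?_ γ
  · intro v hv
    obtain ⟨a, l, hl, he⟩ := hcons v hv
    cases l with
    | nil =>
      simp only [ρ, p, p₀, he, ρ₀, Equiv.symm_apply_apply]
      exact (Ordinal.ToType.mk.symm a.1).2
    | cons b l =>
      simp only [ρ, p, p₀, he, ρ₀, Equiv.symm_apply_apply]
      exact hv₀ ((List.pairwise_cons.1 hl).1 b List.mem_cons_self)
  · intro v β hβ
    have hβα : β < α := by
      refine hβ.trans_le ?_
      simp only [ρ, ρ₀]
      cases (e.symm v).1 with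
      | nil => exact le_rfl
      | cons a l => exact (Ordinal.ToType.mk.symm a.1).2.le
    let x : α.ToType := Ordinal.ToType.mk ⟨β, hβα⟩
    have hx : v₀ x = β := by simp [v₀, x]
    have hlt : ∀ b ∈ (e.symm v).1, x < b.1 := by
      have key : ∀ b : α.ToType, β < v₀ b → x < b := by
        intro b hb
        rw [← Ordinal.ToType.mk.symm.lt_iff_lt, ← Subtype.coe_lt_coe]
        exact hx.trans_lt hb
      rcases he : e.symm v with ⟨l, hl⟩
      cases l with
      | nil => simp
      | cons a l =>
        have ha : x < a.1 := by
          simp only [ρ, ρ₀, he] at hβ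
          exact key _ hβ
        intro b hb
        rcases List.mem_cons.1 hb with rfl | hb
        · exact ha
        · exact ha.trans ((List.pairwise_cons.1 hl).1 b hb)
    let c : Bool → V := fun i =>
      e ⟨(x, i) :: (e.symm v).1, List.pairwise_cons.2 ⟨hlt, (e.symm v).2⟩⟩
    have hcr : ∀ i, c i ≠ r := fun i hi => by
      simpa using congrArg (fun x => x.1) (e.injective hi)
    have hpc : ∀ i, p (c i) = v := fun i => by simp [p, p₀, c]
    have hρc : ∀ i, ρ (c i) = β := fun i => by simp [ρ, ρ₀, c, hx]
    refine ⟨c true, c false, fun hh => ?_, hcr _, hcr _, hpc _, hpc _, hρc _, hρc _⟩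
    simpa using congrArg (fun x => x.1) (e.injective hh)

theorem succ_le_mk_topologicalTypes (hV : ℵ₀ ≤ #V) :
    Order.succ #V ≤
      #(Quot fun (T S : {G : SimpleGraph V // G.IsTree}) => TopEquiv T.1 S.1) := by
  have hα : ∀ a : (Order.succ #V).ord.ToType,
      ((#V).ord + (Ordinal.ToType.mk.symm a).1).card = #V := by
    intro a
    have ha : (Ordinal.ToType.mk.symm a).1 < (Order.succ #V).ord :=
      (Ordinal.ToType.mk.symm a).2
    rw [Ordinal.card_add, card_ord]
    exact add_eq_left hV (Order.lt_succ_iff.1 (lt_ord.1 ha))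
  choose G hG hG' using fun a => exists_rank_tree hV _ (hα a)
  rw [← mk_ord_toType (Order.succ #V)]
  refine mk_le_of_injective (f := fun a => Quot.mk _ ⟨G a, hG a⟩) fun a b hab => ?_
  let F : (Quot fun (T S : {G : SimpleGraph V // G.IsTree}) => TopEquiv T.1 S.1) →
      Set Ordinal.{u} :=
    Quot.lift (fun T => {γ | (T.1.derived γ).Nonempty})
      fun T S h => Set.ext fun γ => h.derived_nonempty_iff γ
  have hF : ∀ γ : Ordinal.{u}, ((G a).derived γ).Nonempty ↔ ((G b).derived γ).Nonempty :=
    fun γ => Set.ext_iff.1 (congrArg F hab) γ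
  simp only [hG'] at hF
  have := add_left_cancel (eq_of_forall_le_iff hF)
  exact Ordinal.ToType.mk.symm.injective (Subtype.ext this)

end LowerBound

/-- For every infinite cardinal `κ`, if `V` is a type of cardinality `κ`, then the quotient
of the set of trees with vertex set `V` by the equivalence `≡` (same topological type)
has cardinality exactly `κ⁺`. -/
theorem number_of_topological_types_of_trees (κ : Cardinal.{u}) (hκ : Cardinal.aleph0 ≤ κ)
    (V : Type u) (hV : Cardinal.mk V = κ) :
    Cardinal.mk (Quot fun (T S : {G : SimpleGraph V // G.IsTree}) => TopEquiv T.1 S.1) =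
      Order.succ κ := by
  subst hV
  exact le_antisymm (mk_topologicalTypes_le hκ) (succ_le_mk_topologicalTypes hκ)
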